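/- arXiv:2504.12175 — 5 statements merged into one kernel-verified Lean document; each statement's English description precedes it below -/
import Mathlib

section
/- Let d_x, n ∈ ℕ, γ ∈ (0,1], K_H > 0. Suppose F: [0,1]^{d_x×n} → ℝ^{d_x×n} is such that each entry function F_{i,j} belongs to the Hölder class H^γ([0,1]^{d_x×n}, K_H). For any K ∈ ℕ and δ ∈ (0, 1/K), there exists a Transformer network N ∈ T_{d_x,d_x}(d_x, 1, 1, 5 n K^{d_x n}, 2) such that: (1) |N_{i,j}(X) − F_{i,j}(X)| ≤ K_H (d_x n)^{γ/2} K^{−γ} for every i ∈ [d_x], j ∈ [n] and every X ∈ [0,1]^{d_x×n} outside the trifling region Ω([0,1]^{d_x×n}, K, δ); and (2) ‖N(X)‖_F ≤ √(d_x n)·K_H for every X ∈ ℝ^{d_x×n}. -/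
open MeasureTheory Matrix

noncomputable section

/-- The column-wise softmax `σ_S`. -/
noncomputable def softmaxCol {d n : ℕ} (A : Matrix (Fin d) (Fin n) ℝ) :
    Matrix (Fin d) (Fin n) ℝ :=
  Matrix.of fun i j => Real.exp (A i j) / ∑ k, Real.exp (A k j)

/-- The entrywise ReLU `σ_R`. -/
def reluM {d n : ℕ} (A : Matrix (Fin d) (Fin n) ℝ) : Matrix (Fin d) (Fin n) ℝ :=
  Matrix.of fun i j => max (A i j) 0

/-- A self-attention layer with `H` heads of head size `S` on `ℝ^{D×n}`. -/
def IsSelfAttn (n D H S : ℕ)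
    (f : Matrix (Fin D) (Fin n) ℝ → Matrix (Fin D) (Fin n) ℝ) : Prop :=
  ∃ (WV WK WQ : Fin H → Matrix (Fin S) (Fin D) ℝ)
    (WO : Fin H → Matrix (Fin D) (Fin S) ℝ),
    ∀ Z, f Z = Z + ∑ h, WO h * ((WV h * Z) * softmaxCol ((WK h * Z)ᵀ * (WQ h * Z)))

/-- A feed-forward layer with hidden dimension `W` on `ℝ^{D×n}`. -/
def IsFeedForward (n D W : ℕ)
    (f : Matrix (Fin D) (Fin n) ℝ → Matrix (Fin D) (Fin n) ℝ) : Prop :=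
  ∃ (W1 : Matrix (Fin W) (Fin D) ℝ) (W2 : Matrix (Fin D) (Fin W) ℝ)
    (b1 : Fin W → ℝ) (b2 : Fin D → ℝ),
    ∀ Z, f Z = Z + W2 * reluM (W1 * Z + Matrix.of fun i _ => b1 i) +
      Matrix.of fun i _ => b2 i

/-- Membership in the transformer class `T_{dx,dy}(D,H,S,W,L)` with sequence length `n`. -/
def IsTransformer (n dx dy D H S W L : ℕ)
    (f : Matrix (Fin dx) (Fin n) ℝ → Matrix (Fin dy) (Fin n) ℝ) : Prop :=
  ∃ (Ain : Matrix (Fin D) (Fin dx) ℝ) (P : Matrix (Fin D) (Fin n) ℝ)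
    (Aout : Matrix (Fin dy) (Fin D) ℝ)
    (SA FF : Fin L → Matrix (Fin D) (Fin n) ℝ → Matrix (Fin D) (Fin n) ℝ),
    (∀ l, IsSelfAttn n D H S (SA l)) ∧ (∀ l, IsFeedForward n D W (FF l)) ∧
    ∀ X, f X = Aout * Fin.foldl L (fun Z l => FF l (SA l Z)) (Ain * X + P)

/-- The Frobenius norm of a real matrix. -/
noncomputable def frobNorm {d n : ℕ} (A : Matrix (Fin d) (Fin n) ℝ) : ℝ :=
  Real.sqrt (∑ i, ∑ j, (A i j) ^ 2)

/-- The unit cube `[0,1]^{d×n}` of matrices. -/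
def unitCube (d n : ℕ) : Set (Matrix (Fin d) (Fin n) ℝ) :=
  {X | ∀ i j, X i j ∈ Set.Icc (0 : ℝ) 1}

/-- The Hölder class `H^γ(Ω, K)`: the sum of the sup-norm and the `γ`-Hölder seminorm
(w.r.t. the Frobenius norm) is at most `K`. -/
def HolderClass {d n : ℕ} (γ K : ℝ) (Ω : Set (Matrix (Fin d) (Fin n) ℝ))
    (f : Matrix (Fin d) (Fin n) ℝ → ℝ) : Prop :=
  ∃ C1 C2 : ℝ, 0 ≤ C1 ∧ 0 ≤ C2 ∧ C1 + C2 ≤ K ∧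
    (∀ X ∈ Ω, |f X| ≤ C1) ∧
    ∀ X ∈ Ω, ∀ Y ∈ Ω, |f X - f Y| ≤ C2 * frobNorm (X - Y) ^ γ

noncomputable instance matrixMeasureSpace {d n : ℕ} :
    MeasureSpace (Matrix (Fin d) (Fin n) ℝ) :=
  inferInstanceAs (MeasureSpace (Fin d → Fin n → ℝ))

/-- The `L^p` norm over the unit cube of a matrix-valued map, measured in Frobenius norm. -/
noncomputable def lpNormCube {d n : ℕ} (p : ℝ)
    (G : Matrix (Fin d) (Fin n) ℝ → Matrix (Fin d) (Fin n) ℝ) : ℝ :=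
  (∫ X in unitCube d n, frobNorm (G X) ^ p) ^ (1 / p)

end

/-- The trifling region `Ω([0,1]^{d×n}, K, δ)`: matrices in the unit cube having some entry
in `∪_{t=1}^{K-1} (t/K, t/K + δ)`. -/
def trifling (d n K : ℕ) (δ : ℝ) : Set (Matrix (Fin d) (Fin n) ℝ) :=
  {X ∈ unitCube d n | ∃ i j, ∃ t ∈ Finset.Icc 1 (K - 1),
    X i j ∈ Set.Ioo ((t : ℝ) / K) ((t : ℝ) / K + δ)}

/-- A ramp that rises from `0` at `k` to `1` at `k + δ`. -/
noncomputable def rampFn (δ k s : ℝ) : ℝ :=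
  max (δ⁻¹ * (s - k)) 0 - max (δ⁻¹ * (s - k) - 1) 0

/-- A continuous approximate step function. -/
noncomputable def stepFn (y : ℕ → ℝ) (L : ℕ) (δ s : ℝ) : ℝ :=
  y 0 + ∑ k ∈ Finset.range L, (y (k + 1) - y k) * rampFn δ ((k + 1 : ℕ) : ℝ) s

lemma rampFn_one {δ k s : ℝ} (hδ : 0 < δ) (h : k + δ ≤ s) : rampFn δ k s = 1 := by
  have h1 : 1 ≤ δ⁻¹ * (s - k) := by
    rw [inv_mul_eq_div, le_div_iff₀ hδ]; linarith
  unfold rampFn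
  rw [max_eq_left (by linarith), max_eq_left (by linarith)]; ring

lemma rampFn_zero {δ k s : ℝ} (hδ : 0 < δ) (h : s ≤ k) : rampFn δ k s = 0 := by
  have h1 : δ⁻¹ * (s - k) ≤ 0 := mul_nonpos_of_nonneg_of_nonpos (by positivity) (by linarith)
  unfold rampFn
  rw [max_eq_right (by linarith), max_eq_right (by linarith)]; ring

lemma rampFn_nonneg (δ k s : ℝ) : 0 ≤ rampFn δ k s := by
  unfold rampFn
  rcases max_cases (δ⁻¹ * (s - k)) 0 with h | h <;>
  rcases max_cases (δ⁻¹ * (s - k) - 1) 0 with h' | h' <;> linarith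

lemma rampFn_le_one (δ k s : ℝ) : rampFn δ k s ≤ 1 := by
  unfold rampFn
  rcases max_cases (δ⁻¹ * (s - k)) 0 with h | h <;>
  rcases max_cases (δ⁻¹ * (s - k) - 1) 0 with h' | h' <;> linarith

lemma rampFn_anti {δ k k' s : ℝ} (hδ : 0 < δ) (hk : k ≤ k') :
    rampFn δ k' s ≤ rampFn δ k s := by
  have h1 : δ⁻¹ * (s - k') ≤ δ⁻¹ * (s - k) :=
    mul_le_mul_of_nonneg_left (by linarith) (by positivity)
  unfold rampFn
  rcases max_cases (δ⁻¹ * (s - k)) 0 with h | h <;>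
  rcases max_cases (δ⁻¹ * (s - k) - 1) 0 with h' | h' <;>
  rcases max_cases (δ⁻¹ * (s - k')) 0 with h2 | h2 <;>
  rcases max_cases (δ⁻¹ * (s - k') - 1) 0 with h2' | h2' <;> linarith

lemma stepFn_eq (y : ℕ → ℝ) (L : ℕ) {δ s : ℝ} (hδ : 0 < δ) (hδ1 : δ ≤ 1) (m : ℕ) (hm : m ≤ L)
    (h1 : (m : ℝ) ≤ s) (h2 : s ≤ m + 1) (h3 : (m : ℝ) + δ ≤ s ∨ y (m - 1) = y m) :
    stepFn y L δ s = y m := by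
  have key : ∀ k ∈ Finset.range L, (y (k + 1) - y k) * rampFn δ ((k + 1 : ℕ) : ℝ) s
      = if k < m then y (k + 1) - y k else 0 := by
    intro k _
    split_ifs with hk
    · rcases Nat.lt_or_ge (k + 1) m with h | h
      · have : ((k + 1 + 1 : ℕ) : ℝ) ≤ m := by exact_mod_cast h
        push_cast at this
        rw [rampFn_one hδ (by push_cast; linarith), mul_one]
      · have hkm : m = k + 1 := by omega
        subst hkm
        rcases h3 with h3 | h3
        · rw [rampFn_one hδ h3, mul_one]
        · simp at h3
          rw [h3]; simp
    · have : (m : ℝ) ≤ k := by exact_mod_cast (not_lt.mp hk)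
      rw [rampFn_zero hδ (by push_cast; linarith), mul_zero]
  unfold stepFn
  rw [Finset.sum_congr rfl key, ← Finset.sum_filter]
  have : (Finset.range L).filter (fun k => k < m) = Finset.range m := by
    ext k; simp; omega
  rw [this, Finset.sum_range_sub]; ring

lemma stepFn_bound (y : ℕ → ℝ) (L : ℕ) {δ s B : ℝ} (hδ : 0 < δ) (hy : ∀ m, |y m| ≤ B) :
    |stepFn y L δ s| ≤ B := by
  have key : |stepFn y L δ s - y L * rampFn δ (L : ℝ) s| ≤ B * (1 - rampFn δ (L : ℝ) s) := by
    induction L with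
    | zero =>
      have : stepFn y 0 δ s - y 0 * rampFn δ ((0 : ℕ) : ℝ) s
          = y 0 * (1 - rampFn δ ((0 : ℕ) : ℝ) s) := by simp [stepFn]; ring
      rw [this, abs_mul, abs_of_nonneg (a := 1 - _) (by linarith [rampFn_le_one δ ((0 : ℕ) : ℝ) s])]
      exact mul_le_mul_of_nonneg_right (hy 0) (by linarith [rampFn_le_one δ ((0 : ℕ) : ℝ) s])
    | succ L ih =>
      have e : stepFn y (L + 1) δ s - y (L + 1) * rampFn δ ((L + 1 : ℕ) : ℝ) s
          = (stepFn y L δ s - y L * rampFn δ (L : ℝ) s)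
            + y L * (rampFn δ (L : ℝ) s - rampFn δ ((L + 1 : ℕ) : ℝ) s) := by
        simp only [stepFn, Finset.sum_range_succ]; ring
      have ha : 0 ≤ rampFn δ (L : ℝ) s - rampFn δ ((L + 1 : ℕ) : ℝ) s :=
        sub_nonneg.mpr (rampFn_anti hδ (by push_cast; linarith))
      rw [e]
      refine (abs_add_le _ _).trans ?_
      rw [abs_mul, abs_of_nonneg ha]
      have := mul_le_mul_of_nonneg_right (hy L) ha
      linarith
  have h1 : |y L * rampFn δ (L : ℝ) s| ≤ B * rampFn δ (L : ℝ) s := by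
    rw [abs_mul, abs_of_nonneg (rampFn_nonneg _ _ _)]
    exact mul_le_mul_of_nonneg_right (hy L) (rampFn_nonneg _ _ _)
  have h2 := abs_add_le (stepFn y L δ s - y L * rampFn δ (L : ℝ) s) (y L * rampFn δ (L : ℝ) s)
  rw [sub_add_cancel] at h2
  linarith

/-- Feed-forward layers with hidden units indexed by an arbitrary finite type. -/
lemma exists_ff (n d W : ℕ) {ι : Type} [Fintype ι] (hW : Fintype.card ι ≤ W)
    (W1 : ι → Fin d → ℝ) (W2 : Fin d → ι → ℝ) (b1 : ι → ℝ) (b2 : Fin d → ℝ) :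
    ∃ f, IsFeedForward n d W f ∧ ∀ Z i j,
      f Z i j = Z i j + ∑ k, W2 i k * max (∑ l, W1 k l * Z l j + b1 k) 0 + b2 i := by
  classical
  obtain ⟨e⟩ : Nonempty (ι ↪ Fin W) :=
    Function.Embedding.nonempty_of_card_le (by simpa using hW)
  refine ⟨_, ⟨Matrix.of fun w l => ∑ k, if e k = w then W1 k l else 0,
    Matrix.of fun i w => ∑ k, if e k = w then W2 i k else 0,
    fun w => ∑ k, if e k = w then b1 k else 0, b2, fun Z => rfl⟩, ?_⟩
  intro Z i j
  simp only [Matrix.add_apply, Matrix.mul_apply, Matrix.of_apply, reluM]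
  congr 2
  simp only [Finset.sum_mul]
  rw [Finset.sum_comm]
  refine Finset.sum_congr rfl fun k _ => ?_
  rw [Finset.sum_eq_single (e k)]
  · simp [e.injective.eq_iff]
  · intro b _ hb
    rw [if_neg (Ne.symm hb), zero_mul]
  · simp

lemma exists_ff_step (n d W : ℕ) {κ : Type} [Fintype κ] [DecidableEq κ] (L : ℕ)
    (hW : 2 * d + 2 * (Fintype.card κ * L) ≤ W) (g : Fin d → κ) (A : κ → Fin d → ℝ)
    (a : κ → ℝ) (y : Fin d → ℕ → ℝ) (δ : ℝ) :
    ∃ f, IsFeedForward n d W f ∧ ∀ Z i j,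
      f Z i j = stepFn (y i) L δ (∑ l, A (g i) l * Z l j + a (g i)) := by
  obtain ⟨f, hf, hfe⟩ := exists_ff n d W (ι := (Fin d ⊕ Fin d) ⊕ ((κ × Fin L) ⊕ (κ × Fin L)))
    (by simp only [Fintype.card_sum, Fintype.card_prod, Fintype.card_fin]; omega)
    (Sum.elim (Sum.elim (fun p l => if p = l then 1 else 0) (fun p l => if p = l then -1 else 0))
      (Sum.elim (fun q l => δ⁻¹ * A q.1 l) (fun q l => δ⁻¹ * A q.1 l)))
    (fun i => Sum.elim (Sum.elim (fun p => if p = i then -1 else 0) (fun p => if p = i then 1 else 0))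
      (Sum.elim (fun q => if g i = q.1 then y i (q.2 + 1) - y i q.2 else 0)
        (fun q => if g i = q.1 then -(y i (q.2 + 1) - y i q.2) else 0)))
    (Sum.elim (fun _ => 0)
      (Sum.elim (fun q => δ⁻¹ * (a q.1 - ((q.2 + 1 : ℕ) : ℝ)))
        (fun q => δ⁻¹ * (a q.1 - ((q.2 + 1 : ℕ) : ℝ)) - 1)))
    (fun i => y i 0)
  refine ⟨f, hf, fun Z i j => ?_⟩
  rw [hfe]
  simp only [Fintype.sum_sum_type, Sum.elim_inl, Sum.elim_inr, Fintype.sum_prod_type]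
  have e1 : ∑ p : Fin d, (if p = i then (-1 : ℝ) else 0) *
      max (∑ l, (if p = l then (1 : ℝ) else 0) * Z l j + 0) 0 = - max (Z i j) 0 := by
    simp
  have e2 : ∑ p : Fin d, (if p = i then (1 : ℝ) else 0) *
      max (∑ l, (if p = l then (-1 : ℝ) else 0) * Z l j + 0) 0 = max (-Z i j) 0 := by
    simp
  rw [e1, e2]
  have e3 : ∀ c : κ → Fin L → ℝ, ∀ h : κ → Fin L → ℝ,
      ∑ q, ∑ m, (if g i = q then c q m else 0) * h q m = ∑ m, c (g i) m * h (g i) m := by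
    intro c h
    rw [Finset.sum_eq_single (g i)]
    · simp
    · intro b _ hb
      simp [Ne.symm hb]
    · simp
  rw [e3 (fun _ m => y i (m + 1) - y i m), e3 (fun _ m => -(y i (m + 1) - y i m))]
  rw [stepFn, ← Fin.sum_univ_eq_sum_range
    (fun k => (y i (k + 1) - y i k) * rampFn δ ((k + 1 : ℕ) : ℝ) (∑ l, A (g i) l * Z l j + a (g i)))]
  rw [← Finset.sum_add_distrib]
  have e4 : Z i j + (-max (Z i j) 0 + max (-Z i j) 0) = 0 := by
    rcases max_cases (Z i j) 0 with h | h <;> rcases max_cases (-Z i j) 0 with h' | h' <;> linarith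
  rw [← add_assoc, e4, zero_add, add_comm]
  congr 1
  refine Finset.sum_congr rfl fun m _ => ?_
  have e5 : ∑ l, δ⁻¹ * A (g i) l * Z l j = δ⁻¹ * ∑ l, A (g i) l * Z l j := by
    rw [Finset.mul_sum]; exact Finset.sum_congr rfl fun _ _ => by ring
  rw [e5, rampFn]
  have e6 : ∀ S : ℝ, δ⁻¹ * S + δ⁻¹ * (a (g i) - ((m + 1 : ℕ) : ℝ))
      = δ⁻¹ * (S + a (g i) - ((m + 1 : ℕ) : ℝ)) := fun S => by ring
  rw [← add_sub_assoc, e6]; ring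

lemma selfAttn_id (n d : ℕ) : IsSelfAttn n d 1 1 (fun Z => Z) :=
  ⟨0, 0, 0, 0, fun Z => by simp⟩

lemma exists_selfAttn_mean (n d : ℕ) (c : ℝ) :
    ∃ f, IsSelfAttn n d 1 1 f ∧ ∀ Z i j, f Z i j = Z i j + c * ∑ k : Fin n, (∑ l, Z l k) / n := by
  refine ⟨_, ⟨fun _ => Matrix.of fun _ _ => 1, 0, 0, fun _ => Matrix.of fun _ _ => c,
    fun Z => rfl⟩, fun Z i j => ?_⟩
  simp [Matrix.mul_apply, softmaxCol, div_eq_mul_inv]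

lemma exists_digit (K : ℕ) (hK : 0 < K) (δ x : ℝ) (h0 : 0 ≤ x) (h1 : x ≤ 1)
    (hx : ∀ t ∈ Finset.Icc 1 (K - 1), x ∉ Set.Ioo ((t : ℝ) / K) ((t : ℝ) / K + δ)) :
    ∃ t : Fin K, (t : ℝ) ≤ K * x ∧ K * x ≤ t + 1 ∧ ((t : ℝ) + K * δ ≤ K * x ∨ (t : ℕ) = 0) := by
  have hK' : (0 : ℝ) < K := by exact_mod_cast hK
  have hc1 : ⌈(K : ℝ) * x⌉₊ ≤ K := by
    rw [Nat.ceil_le]; nlinarith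
  rcases Nat.eq_zero_or_pos ⌈(K : ℝ) * x⌉₊ with hc | hc
  · refine ⟨⟨0, hK⟩, ?_, ?_, Or.inr rfl⟩
    · simp; positivity
    · rw [Nat.ceil_eq_zero] at hc; simp; linarith
  · obtain ⟨t, ht⟩ : ∃ t, ⌈(K : ℝ) * x⌉₊ = t + 1 := ⟨_, (Nat.succ_pred_eq_of_pos hc).symm⟩
    have hle : (K : ℝ) * x ≤ t + 1 := by
      have := Nat.le_ceil ((K : ℝ) * x); rw [ht] at this; exact_mod_cast this
    have hlt : (t : ℝ) < K * x := by
      rw [← Nat.lt_ceil]; omega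
    refine ⟨⟨t, by omega⟩, hlt.le, hle, ?_⟩
    rcases Nat.eq_zero_or_pos t with h | h
    · exact Or.inr h
    · left
      have := hx t (Finset.mem_Icc.mpr ⟨h, by omega⟩)
      rw [Set.mem_Ioo, not_and] at this
      have h2 := this (by rw [div_lt_iff₀ hK']; linarith)
      push Not at h2
      have h3 : (t : ℝ) / K * K = t := by field_simp
      show (t : ℝ) + K * δ ≤ K * x
      nlinarith

lemma frob_le {d n : ℕ} (A : Matrix (Fin d) (Fin n) ℝ) (B : ℝ) (hB : 0 ≤ B)
    (h : ∀ i j, |A i j| ≤ B) : frobNorm A ≤ Real.sqrt ((d : ℝ) * n) * B := by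
  unfold frobNorm
  apply Real.sqrt_le_iff.mpr
  refine ⟨by positivity, ?_⟩
  rw [mul_pow, Real.sq_sqrt (by positivity)]
  calc ∑ i, ∑ j, (A i j) ^ 2 ≤ ∑ _i : Fin d, ∑ _j : Fin n, B ^ 2 :=
        Finset.sum_le_sum fun i _ => Finset.sum_le_sum fun j _ => by
          rw [← sq_abs]; exact pow_le_pow_left₀ (abs_nonneg _) (h i j) 2
    _ = _ := by simp; ring

lemma ff_id (n d W : ℕ) : IsFeedForward n d W (fun Z => Z) := by
  refine ⟨0, 0, 0, 0, fun Z => ?_⟩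
  ext i j; simp

lemma width_aux (d n K : ℕ) (hd : 0 < d) (hn : 0 < n) (hK : 2 ≤ K) :
    d * K ≤ K ^ (d * n) := by
  have h1 : d ≤ K ^ (d - 1) := by
    have h := Nat.lt_pow_self (n := d - 1) (show 1 < K by omega)
    omega
  calc d * K ≤ K ^ (d - 1) * K := Nat.mul_le_mul_right _ h1
    _ = K ^ d := by rw [← pow_succ]; congr 1; omega
    _ ≤ K ^ (d * n) := Nat.pow_le_pow_right (by omega) (Nat.le_mul_of_pos_right _ hn)

/-- values of the first feed-forward layer -/
noncomputable def vCode (d n K : ℕ) (i j r : ℕ) : ℝ :=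
  (r : ℝ) * (K : ℝ) ^ (j + n * i) / ((K ^ (d * n) : ℕ) : ℝ) + (j : ℝ) / d

/-- step values of the first feed-forward layer -/
noncomputable def yOne (d n K : ℕ) (i m : ℕ) : ℝ :=
  if m % (K + 1) < K then vCode d n K i (m / (K + 1)) (m % (K + 1))
  else vCode d n K i (m / (K + 1) + 1) 0

lemma yOne_eq (d n K i j r : ℕ) (hr : r < K) :
    yOne d n K i ((K + 1) * j + r) = vCode d n K i j r := by
  have h1 : ((K + 1) * j + r) % (K + 1) = r := by
    rw [Nat.mul_add_mod]; exact Nat.mod_eq_of_lt (by omega)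
  have h2 : ((K + 1) * j + r) / (K + 1) = j := by
    rw [Nat.mul_add_div (by omega), Nat.div_eq_of_lt (by omega), add_zero]
  simp [yOne, h1, h2, hr]

lemma yOne_prev (d n K i j : ℕ) (hK : 0 < K) :
    yOne d n K i ((K + 1) * j - 1) = yOne d n K i ((K + 1) * j) := by
  cases j with
  | zero => simp
  | succ j =>
    have h0 : (K + 1) * (j + 1) - 1 = (K + 1) * j + K := by
      rw [Nat.mul_add, Nat.mul_one]; omega
    have h1 : ((K + 1) * j + K) % (K + 1) = K := by
      rw [Nat.mul_add_mod]; exact Nat.mod_eq_of_lt (by omega)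
    have h2 : ((K + 1) * j + K) / (K + 1) = j := by
      rw [Nat.mul_add_div (by omega), Nat.div_eq_of_lt (by omega), add_zero]
    have h3 := yOne_eq d n K i (j + 1) 0 hK
    rw [add_zero] at h3
    rw [h3, h0]
    simp [yOne, h1, h2]

/-- code of a grid cell -/
def codeOf {d n K : ℕ} (t : Fin d → Fin n → Fin K) : Fin (K ^ (d * n)) :=
  finFunctionFinEquiv (fun e => t (finProdFinEquiv.symm e).1 (finProdFinEquiv.symm e).2)

/-- grid point with a given code -/
noncomputable def gridPt (d n K : ℕ) (c : Fin (K ^ (d * n))) : Matrix (Fin d) (Fin n) ℝ :=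
  Matrix.of fun i j => (((finFunctionFinEquiv.symm c) (finProdFinEquiv (i, j)) : ℕ) : ℝ) / K

lemma gridPt_codeOf {d n K : ℕ} (t : Fin d → Fin n → Fin K) (i : Fin d) (j : Fin n) :
    gridPt d n K (codeOf t) i j = ((t i j : ℕ) : ℝ) / K := by
  simp only [gridPt, codeOf, Matrix.of_apply, Equiv.symm_apply_apply]

lemma gridPt_mem (d n K : ℕ) (hK : 0 < K) (c : Fin (K ^ (d * n))) :
    gridPt d n K c ∈ unitCube d n := by
  intro i j
  have hK' : (0 : ℝ) < K := by exact_mod_cast hK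
  simp only [gridPt, Matrix.of_apply, Set.mem_Icc]
  refine ⟨by positivity, ?_⟩
  rw [div_le_one hK']
  exact_mod_cast (Fin.is_lt _).le

lemma codeOf_val {d n K : ℕ} (t : Fin d → Fin n → Fin K) :
    ((codeOf t : Fin _) : ℕ) = ∑ j : Fin n, ∑ i : Fin d, (t i j : ℕ) * K ^ ((j : ℕ) + n * i) := by
  rw [codeOf, finFunctionFinEquiv_apply, ← finProdFinEquiv.sum_comp, Fintype.sum_prod_type,
    Finset.sum_comm]
  simp

/-- step values of the second feed-forward layer -/
noncomputable def yTwo {d n K : ℕ} (hn : 0 < n) (hM : 0 < K ^ (d * n))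
    (F : Matrix (Fin d) (Fin n) ℝ → Matrix (Fin d) (Fin n) ℝ) (i : Fin d) (m : ℕ) : ℝ :=
  F (gridPt d n K ⟨(m / n) % K ^ (d * n), Nat.mod_lt _ hM⟩) i ⟨m % n, Nat.mod_lt _ hn⟩

lemma yTwo_eq {d n K : ℕ} (hn : 0 < n) (hM : 0 < K ^ (d * n))
    (F : Matrix (Fin d) (Fin n) ℝ → Matrix (Fin d) (Fin n) ℝ) (i : Fin d) (j : Fin n)
    (c : Fin (K ^ (d * n))) :
    yTwo hn hM F i (n * c + j) = F (gridPt d n K c) i j := by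
  have h1 : (n * (c : ℕ) + j) % n = j := by
    rw [Nat.mul_add_mod]; exact Nat.mod_eq_of_lt j.2
  have h2 : (n * (c : ℕ) + j) / n % K ^ (d * n) = c := by
    rw [Nat.mul_add_div hn, Nat.div_eq_of_lt j.2, add_zero]; exact Nat.mod_eq_of_lt c.2
  simp [yTwo, h1, h2]

theorem net_exists (d n : ℕ) (hd : 0 < d) (hn : 0 < n) (KH : ℝ)
    (F : Matrix (Fin d) (Fin n) ℝ → Matrix (Fin d) (Fin n) ℝ)
    (hF : ∀ i j, ∀ X ∈ unitCube d n, |F X i j| ≤ KH)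
    (K : ℕ) (hK : 2 ≤ K) (δ : ℝ) (hδ : 0 < δ) (hδ1 : K * δ ≤ 1) :
    ∃ N : Matrix (Fin d) (Fin n) ℝ → Matrix (Fin d) (Fin n) ℝ,
      IsTransformer n d d d 1 1 (5 * n * K ^ (d * n)) 2 N ∧
      (∀ X i j, |N X i j| ≤ KH) ∧
      ∀ X, ∀ t : Fin d → Fin n → Fin K, (∀ i j, ((t i j : ℕ) : ℝ) ≤ (K : ℝ) * X i j ∧ (K : ℝ) * X i j ≤ ((t i j : ℕ) : ℝ) + 1 ∧
        (((t i j : ℕ) : ℝ) + (K : ℝ) * δ ≤ (K : ℝ) * X i j ∨ (t i j : ℕ) = 0)) →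
        ∀ i j, N X i j = F (gridPt d n K (codeOf t)) i j := by
  have hM : 0 < K ^ (d * n) := Nat.pow_pos (by omega)
  have hwid := width_aux d n K hd hn hK
  have hK' : (0 : ℝ) < K := by exact_mod_cast (show 0 < K by omega)
  have hM' : (0 : ℝ) < ((K ^ (d * n) : ℕ) : ℝ) := by exact_mod_cast hM
  have hn' : (0 : ℝ) < n := by exact_mod_cast hn
  have hd' : (0 : ℝ) < d := by exact_mod_cast hd
  have hw0 : 2 * d ≤ n * (d * K) := by
    have h1 := Nat.mul_le_mul_left d hK
    have h2 := Nat.le_mul_of_pos_left (d * K) hn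
    linarith
  have hw1 : n * (d * K) ≤ n * K ^ (d * n) := Nat.mul_le_mul_left _ hwid
  obtain ⟨ff1, hff1, e1⟩ := exists_ff_step n d (5 * n * K ^ (d * n)) (κ := Fin d) ((K + 1) * n)
    (by
      rw [Fintype.card_fin]
      have h3 : 2 * (d * n) ≤ n * (d * K) := by nlinarith [Nat.mul_le_mul_left (d * n) hK]
      nlinarith) id
    (fun i l => if i = l then 1 else 0) (fun _ => 0) (fun i => yOne d n K i) (K * δ)
  obtain ⟨ff2, hff2, e2⟩ := exists_ff_step n d (5 * n * K ^ (d * n)) (κ := Unit) (n * K ^ (d * n))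
    (by rw [Fintype.card_unit]; nlinarith) (fun _ => ())
    (fun _ _ => 1)
    (fun _ => 1 / ((K ^ (d * n) : ℕ) : ℝ) - n * ((K ^ (d * n) : ℕ) : ℝ) * ∑ k : Fin n, (k : ℝ))
    (yTwo hn hM F) (1 / ((K ^ (d * n) : ℕ) : ℝ))
  obtain ⟨sa, hsa, e3⟩ := exists_selfAttn_mean n d (n * (n * ((K ^ (d * n) : ℕ) : ℝ)) / d)
  refine ⟨fun X => ff2 (sa (ff1 ((K : ℝ) • X + Matrix.of fun (_ : Fin d) (j : Fin n) => ((K : ℝ) + 1) * ((j : ℕ) : ℝ)))),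
    ⟨(K : ℝ) • 1, Matrix.of fun (_ : Fin d) (j : Fin n) => ((K : ℝ) + 1) * ((j : ℕ) : ℝ), 1, ![fun Z => Z, sa], ![ff1, ff2],
      ?_, ?_, ?_⟩, ?_, ?_⟩
  · exact Fin.forall_fin_two.mpr ⟨selfAttn_id n d, hsa⟩
  · exact Fin.forall_fin_two.mpr ⟨hff1, hff2⟩
  · intro X
    simp [Fin.foldl_succ, Fin.foldl_zero]
  · intro X i j
    dsimp only
    rw [e2]
    refine stepFn_bound _ _ (by positivity) fun m => ?_
    exact hF _ _ _ (gridPt_mem d n K (by omega) _)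
  · intro X t ht i j
    dsimp only
    set Z := ff1 ((K : ℝ) • X + Matrix.of fun (_ : Fin d) (j : Fin n) => ((K : ℝ) + 1) * ((j : ℕ) : ℝ)) with hZ
    have hZe : ∀ i j, Z i j = vCode d n K i j (t i j) := by
      intro i j
      obtain ⟨h1, h2, h3⟩ := ht i j
      rw [hZ, e1, ← yOne_eq d n K i j (t i j) (t i j).2]
      have hs : ∑ l, (if id i = l then (1 : ℝ) else 0) *
          ((K : ℝ) • X + Matrix.of fun (_ : Fin d) (j : Fin n) => ((K : ℝ) + 1) * ((j : ℕ) : ℝ)) l j + 0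
          = K * X i j + (K + 1) * (j : ℕ) := by simp
      rw [hs]
      refine stepFn_eq _ _ (by positivity) hδ1 _ ?_ ?_ ?_ ?_
      · have := j.2
        have := (t i j).2
        nlinarith [Nat.mul_le_mul_left (K + 1) (show (j : ℕ) + 1 ≤ n from j.2)]
      · push_cast; linarith
      · push_cast; linarith
      · rcases h3 with h3 | h3
        · left; push_cast; linarith
        · right
          rw [h3, add_zero]
          exact yOne_prev d n K i j (by omega)
    set U : Fin n → ℕ := fun j => ∑ i : Fin d, (t i j : ℕ) * K ^ ((j : ℕ) + n * i) with hU
    have hcol : ∀ j, ∑ i, Z i j = (U j : ℝ) / ((K ^ (d * n) : ℕ) : ℝ) + (j : ℕ) := by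
      intro j
      simp only [hZe, vCode, Finset.sum_add_distrib, ← Finset.sum_div, hU]
      congr 1
      · push_cast; rfl
      · simp; field_simp
    have hc : ((codeOf t : ℕ) : ℝ) = ∑ j, (U j : ℝ) := by
      rw [codeOf_val]; push_cast [hU]; rfl
    have hUc : U j ≤ (codeOf t : ℕ) := by
      rw [codeOf_val]
      exact Finset.single_le_sum (f := U) (fun _ _ => Nat.zero_le _) (Finset.mem_univ j)
    have hUM : (U j : ℝ) + 1 ≤ ((K ^ (d * n) : ℕ) : ℝ) := by
      exact_mod_cast lt_of_le_of_lt hUc (codeOf t).2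
    rw [e2, ← yTwo_eq hn hM F i j (codeOf t)]
    have htot : ∑ k : Fin n, (∑ l, Z l k) / (n : ℝ)
        = (((codeOf t : ℕ) : ℝ) / ((K ^ (d * n) : ℕ) : ℝ) + ∑ k : Fin n, ((k : ℕ) : ℝ)) / n := by
      rw [← Finset.sum_div]
      simp only [hcol, Finset.sum_add_distrib, ← Finset.sum_div]
      rw [hc]
    have hs : ∑ l, (1 : ℝ) * sa Z l j + (1 / ((K ^ (d * n) : ℕ) : ℝ)
          - n * ((K ^ (d * n) : ℕ) : ℝ) * ∑ k : Fin n, ((k : ℕ) : ℝ))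
        = ((n * (codeOf t : ℕ) + (j : ℕ) : ℕ) : ℝ) + ((U j : ℝ) + 1) / ((K ^ (d * n) : ℕ) : ℝ) := by
      simp only [one_mul, e3, htot]
      simp only [Finset.sum_add_distrib, hcol, Finset.sum_const,
        Finset.card_univ, Fintype.card_fin, nsmul_eq_mul]
      rw [Nat.cast_add, Nat.cast_mul]
      generalize (((K ^ (d * n) : ℕ)) : ℝ) = M at *
      field_simp
      ring
    rw [hs]
    refine stepFn_eq _ _ (by positivity) ?_ _ ?_ ?_ ?_ (Or.inl ?_)
    · rw [div_le_one hM']; exact_mod_cast hM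
    · have h1 := j.2
      have h2 : (codeOf t : ℕ) + 1 ≤ K ^ (d * n) := (codeOf t).2
      nlinarith [Nat.mul_le_mul_left n h2]
    · have : 0 ≤ ((U j : ℝ) + 1) / ((K ^ (d * n) : ℕ) : ℝ) := by positivity
      linarith
    · have : ((U j : ℝ) + 1) / ((K ^ (d * n) : ℕ) : ℝ) ≤ 1 := by rw [div_le_one hM']; exact hUM
      linarith
    · have : 1 / ((K ^ (d * n) : ℕ) : ℝ) ≤ ((U j : ℝ) + 1) / ((K ^ (d * n) : ℕ) : ℝ) := by
        apply div_le_div_of_nonneg_right _ hM'.le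
        have : (0 : ℝ) ≤ U j := by positivity
        linarith
      linarith

/-- Proposition 2: approximation of entrywise Hölder functions by a
transformer outside the trifling region, with a global Frobenius-norm bound. -/
theorem transformer_approx_outside_trifling
    (dx n : ℕ) (hdx : 0 < dx) (hn : 0 < n) (γ KH : ℝ)
    (hγ : γ ∈ Set.Ioc (0 : ℝ) 1) (hKH : 0 < KH)
    (F : Matrix (Fin dx) (Fin n) ℝ → Matrix (Fin dx) (Fin n) ℝ)
    (hF : ∀ i j, HolderClass γ KH (unitCube dx n) (fun X => F X i j))
    (K : ℕ) (hK : 0 < K) (δ : ℝ) (hδ : δ ∈ Set.Ioo (0 : ℝ) (1 / K)) :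
    ∃ N : Matrix (Fin dx) (Fin n) ℝ → Matrix (Fin dx) (Fin n) ℝ,
      IsTransformer n dx dx dx 1 1 (5 * n * K ^ (dx * n)) 2 N ∧
      (∀ i j, ∀ X ∈ unitCube dx n \ trifling dx n K δ,
        |N X i j - F X i j| ≤ KH * ((dx : ℝ) * n) ^ (γ / 2) * (K : ℝ) ^ (-γ)) ∧
      ∀ X, frobNorm (N X) ≤ Real.sqrt ((dx : ℝ) * n) * KH := by
  have hK' : (0 : ℝ) < K := by exact_mod_cast hK
  have hFb : ∀ i j, ∀ X ∈ unitCube dx n, |F X i j| ≤ KH := by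
    intro i j X hX
    obtain ⟨C1, C2, h1, h2, h3, h4, h5⟩ := hF i j
    have := h4 X hX
    dsimp only at this
    linarith
  rcases Nat.lt_or_ge K 2 with hK2 | hK2
  · have hK1 : K = 1 := by omega
    subst hK1
    refine ⟨fun _ => 0, ⟨0, 0, 0, fun _ Z => Z, fun _ Z => Z, fun _ => selfAttn_id _ _,
      fun _ => ff_id _ _ _, fun X => by simp⟩, ?_, ?_⟩
    · intro i j X hX
      have h1 : (1 : ℝ) ≤ ((dx : ℝ) * n) ^ (γ / 2) := by
        apply Real.one_le_rpow
        · exact_mod_cast Nat.mul_pos hdx hn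
        · linarith [hγ.1]
      have h2 := hFb i j X hX.1
      simp only [Matrix.zero_apply, zero_sub, abs_neg, Nat.cast_one, Real.one_rpow, mul_one]
      nlinarith
    · intro X
      exact frob_le _ _ hKH.le fun i j => by simpa using hKH.le
  · have hδ1 : (K : ℝ) * δ ≤ 1 := by
      have := hδ.2
      rw [lt_div_iff₀ hK'] at this
      linarith
    obtain ⟨N, hN, hNb, hNe⟩ := net_exists dx n hdx hn KH F hFb K hK2 δ hδ.1 hδ1
    refine ⟨N, hN, ?_, fun X => frob_le _ _ hKH.le (hNb X)⟩
    intro i j X hX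
    have hdig : ∀ i j, ∃ t : Fin K, (t : ℝ) ≤ K * X i j ∧ K * X i j ≤ t + 1 ∧
        ((t : ℝ) + K * δ ≤ K * X i j ∨ (t : ℕ) = 0) := by
      intro i j
      refine exists_digit K hK δ (X i j) (hX.1 i j).1 (hX.1 i j).2 ?_
      intro t ht hmem
      exact hX.2 ⟨hX.1, i, j, t, ht, hmem⟩
    choose t ht using hdig
    rw [hNe X t ht i j]
    obtain ⟨C1, C2, h1, h2, h3, h4, h5⟩ := hF i j
    refine (h5 _ (gridPt_mem dx n K hK (codeOf t)) X hX.1).trans ?_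
    have hfr : frobNorm (gridPt dx n K (codeOf t) - X) ≤ Real.sqrt ((dx : ℝ) * n) * (1 / K) := by
      apply frob_le _ _ (by positivity)
      intro i j
      obtain ⟨ha, hb, -⟩ := ht i j
      rw [Matrix.sub_apply, gridPt_codeOf, abs_le]
      have e : ((t i j : ℕ) : ℝ) / K - X i j = (((t i j : ℕ) : ℝ) - K * X i j) / K := by
        field_simp
      rw [e, ← neg_div]
      exact ⟨div_le_div_of_nonneg_right (by linarith) hK'.le,
        div_le_div_of_nonneg_right (by linarith) hK'.le⟩
    have hfr0 : 0 ≤ frobNorm (gridPt dx n K (codeOf t) - X) := Real.sqrt_nonneg _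
    have hpow := Real.rpow_le_rpow hfr0 hfr hγ.1.le
    have he : (Real.sqrt ((dx : ℝ) * n) * (1 / K)) ^ γ
        = ((dx : ℝ) * n) ^ (γ / 2) * (K : ℝ) ^ (-γ) := by
      rw [Real.mul_rpow (Real.sqrt_nonneg _) (by positivity), Real.sqrt_eq_rpow,
        ← Real.rpow_mul (by positivity), one_div (K : ℝ), Real.inv_rpow hK'.le, Real.rpow_neg hK'.le]
      congr 2
      ring
    rw [he] at hpow
    rw [mul_assoc]
    exact mul_le_mul (by linarith) hpow (Real.rpow_nonneg hfr0 _) hKH.le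
end

section
/- Let d_x, n ∈ ℕ, γ ∈ (0,1], K_H > 0, and suppose F: [0,1]^{d_x×n} → ℝ^{d_x×n} is such that each entry function F_{i,j} belongs to the Hölder class H^γ([0,1]^{d_x×n}, K_H). Let ε > 0, K ∈ ℕ and δ ∈ (0, 1/(3K)]. If Ñ ∈ T_{d_x,d_x}(D, H, S, W, L) is a Transformer network satisfying |Ñ_{i,j}(X) − F_{i,j}(X)| ≤ ε for all i ∈ [d_x], j ∈ [n] and all X ∈ [0,1]^{d_x×n} outside the trifling region Ω([0,1]^{d_x×n}, K, δ), then there exists a Transformer network N ∈ T_{d_x,d_x}(3^{d_x n}·max{D, 5 d_x}, 3^{d_x n}·H, S, 3^{d_x n}·max{W, 14 d_x}, L + 2 d_x n) such that |N_{i,j}(X) − F_{i,j}(X)| ≤ ε + d_x n K_H δ^γ for all i ∈ [d_x], j ∈ [n] and all X ∈ [0,1]^{d_x×n}. -/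
open MeasureTheory Matrix

/-- Embedding-plus-`L`-layers part of a transformer. -/
def TBody (n dx D H S W L : ℕ)
    (f : Matrix (Fin dx) (Fin n) ℝ → Matrix (Fin D) (Fin n) ℝ) : Prop :=
  ∃ (Ain : Matrix (Fin D) (Fin dx) ℝ) (P : Matrix (Fin D) (Fin n) ℝ)
    (SA FF : Fin L → Matrix (Fin D) (Fin n) ℝ → Matrix (Fin D) (Fin n) ℝ),
    (∀ l, IsSelfAttn n D H S (SA l)) ∧ (∀ l, IsFeedForward n D W (FF l)) ∧
    ∀ X, f X = Fin.foldl L (fun Z l => FF l (SA l Z)) (Ain * X + P)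

theorem TBody.zero {n dx D H S W : ℕ} (Ain : Matrix (Fin D) (Fin dx) ℝ)
    (P : Matrix (Fin D) (Fin n) ℝ) : TBody n dx D H S W 0 (fun X => Ain * X + P) :=
  ⟨Ain, P, fun l => l.elim0, fun l => l.elim0, fun l => l.elim0, fun l => l.elim0,
    fun X => by simp⟩

theorem TBody.succ {n dx D H S W L : ℕ}
    {f : Matrix (Fin dx) (Fin n) ℝ → Matrix (Fin D) (Fin n) ℝ}
    (hf : TBody n dx D H S W L f)
    {g h : Matrix (Fin D) (Fin n) ℝ → Matrix (Fin D) (Fin n) ℝ}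
    (hg : IsSelfAttn n D H S g) (hh : IsFeedForward n D W h) :
    TBody n dx D H S W (L + 1) (fun X => h (g (f X))) := by
  obtain ⟨Ain, P, SA, FF, h1, h2, h3⟩ := hf
  refine ⟨Ain, P, Fin.snoc (α := fun _ => _) SA g, Fin.snoc (α := fun _ => _) FF h, ?_, ?_, ?_⟩
  · intro l
    refine Fin.lastCases ?_ (fun l => ?_) l
    · simpa using hg
    · simpa using h1 l
  · intro l
    refine Fin.lastCases ?_ (fun l => ?_) l
    · simpa using hh
    · simpa using h2 l
  · intro X
    rw [Fin.foldl_succ_last]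
    simp [h3]

theorem isSelfAttn_id (n D H S : ℕ) : IsSelfAttn n D H S (fun Z => Z) :=
  ⟨0, 0, 0, 0, fun Z => by simp⟩

theorem ff_of {n D W : ℕ} {ω : Type} [Fintype ω] (hW : Fintype.card ω ≤ W)
    (A : ω → Fin D → ℝ) (G : Fin D → ω → ℝ) (b1 : ω → ℝ) (b2 : Fin D → ℝ) :
    IsFeedForward n D W (fun Z => Matrix.of fun p j =>
      Z p j + ∑ w, G p w * max (∑ q, A w q * Z q j + b1 w) 0 + b2 p) := by
  have e : Fin W ≃ ω ⊕ Fin (W - Fintype.card ω) :=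
    (Fintype.equivFinOfCardEq (by simp; omega)).symm
  refine ⟨Matrix.of fun w q => Sum.elim (fun o => A o q) (fun _ => 0) (e w),
    Matrix.of fun p w => Sum.elim (fun o => G p o) (fun _ => 0) (e w),
    fun w => Sum.elim b1 (fun _ => 0) (e w), b2, fun Z => ?_⟩
  ext p j
  simp only [Matrix.of_apply, Matrix.add_apply, Matrix.mul_apply, reluM]
  congr 2
  rw [← e.symm.sum_comp, Fintype.sum_sum_type]
  simp

/-- Overwrite a family of cells by linear plus ReLU features. -/
theorem ff_overwrite {n D W : ℕ} {κ ρ : Type} [Fintype κ] [Fintype ρ]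
    (hW : 2 * Fintype.card κ + Fintype.card ρ ≤ W) (cell : κ → Fin D)
    (hc : Function.Injective cell) (l : κ → Fin D → ℝ) (m : ρ → Fin D → ℝ) (Q : κ → ρ → ℝ) :
    ∃ f, IsFeedForward n D W f ∧ ∀ Z k j, f Z (cell k) j =
      ∑ q, l k q * Z q j + ∑ r, Q k r * max (∑ q, m r q * Z q j) 0 := by
  classical
  refine ⟨_, ff_of (ω := (κ ⊕ κ) ⊕ ρ) (by simp; omega)
    (Sum.elim (Sum.elim (fun k q => l k q - if q = cell k then 1 else 0)
      (fun k q => -(l k q - if q = cell k then 1 else 0))) m)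
    (fun p => Sum.elim (Sum.elim (fun k => if p = cell k then 1 else 0)
      (fun k => if p = cell k then -1 else 0))
      (fun r => ∑ k, if p = cell k then Q k r else 0)) (fun _ => 0) (fun _ => 0), ?_⟩
  intro Z k j
  have hmax : ∀ x : ℝ, max x 0 + -max (-x) 0 = x := by
    intro x
    rcases le_total x 0 with h | h
    · rw [max_eq_right h, max_eq_left (by linarith)]; ring
    · rw [max_eq_left h, max_eq_right (by linarith)]; ring
  simp only [Matrix.of_apply, Fintype.sum_sum_type, Sum.elim_inl, Sum.elim_inr, hc.eq_iff,
    add_zero, ite_mul, zero_mul, one_mul, neg_mul, Finset.sum_ite_eq, Finset.mem_univ, if_true,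
    Finset.sum_neg_distrib, sub_mul, Finset.sum_sub_distrib, Finset.sum_ite_eq']
  rw [hmax]
  ring

/-- The median of three reals. -/
def med3 (a b c : ℝ) : ℝ := c - max (c - max a b) 0 + max (min a b - c) 0

theorem med3_near {a b c y e : ℝ}
    (h : (|a - y| ≤ e ∧ |b - y| ≤ e) ∨ (|a - y| ≤ e ∧ |c - y| ≤ e) ∨
      (|b - y| ≤ e ∧ |c - y| ≤ e)) : |med3 a b c - y| ≤ e := by
  unfold med3
  simp only [abs_le] at *
  rcases le_total a b with h1 | h1 <;> rcases le_total c a with h2 | h2 <;>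
    rcases le_total c b with h3 | h3 <;>
    simp only [max_eq_left, max_eq_right, min_eq_left, min_eq_right, h1, h2, h3, sub_nonneg,
      sub_nonpos] <;> rcases h with h | h | h <;> constructor <;> linarith [h.1.1, h.1.2, h.2.1, h.2.2]

theorem level_layers {n dx D M W : ℕ} {β : Type} [Fintype β]
    (hM : 2 * dx ≤ M) (hW : Fintype.card β * (5 * dx) ≤ W)
    (c : β × Fin M → Fin D) (hc : Function.Injective c)
    (Rd : β → Matrix (Fin dx) (Fin D) ℝ) (s0 s1 s2 : β → β) :
    ∃ (f1 f2 : Matrix (Fin D) (Fin n) ℝ → Matrix (Fin D) (Fin n) ℝ)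
      (Rd' : β → Matrix (Fin dx) (Fin D) ℝ),
      IsFeedForward n D W f1 ∧ IsFeedForward n D W f2 ∧
      ∀ Z b i j, (Rd' b * f2 (f1 Z)) i j =
        med3 ((Rd (s0 b) * Z) i j) ((Rd (s1 b) * Z) i j) ((Rd (s2 b) * Z) i j) := by
  classical
  let vc : β × Fin dx → Fin D := fun x => c (x.1, ⟨x.2, by omega⟩)
  let rc : β × Fin dx → Fin D := fun x => c (x.1, ⟨dx + x.2, by omega⟩)
  have hvc : Function.Injective vc := by
    rintro ⟨b, i⟩ ⟨b', i'⟩ h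
    have := hc h
    simp only [Prod.mk.injEq, Fin.mk.injEq] at this
    exact Prod.ext this.1 (Fin.ext this.2)
  have hrc : Function.Injective rc := by
    rintro ⟨b, i⟩ ⟨b', i'⟩ h
    have := hc h
    simp only [Prod.mk.injEq, Fin.mk.injEq] at this
    exact Prod.ext this.1 (Fin.ext (by have := this.2; dsimp only; omega))
  have hvr : ∀ x y, vc x ≠ rc y := by
    rintro ⟨b, i⟩ ⟨b', i'⟩ h
    have := hc h
    simp only [Prod.mk.injEq, Fin.mk.injEq] at this
    omega
  obtain ⟨f1, hf1, h1⟩ := ff_overwrite (n := n) (W := W)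
    (κ := (β × Fin dx) ⊕ (β × Fin dx)) (ρ := β × Fin dx)
    (by simp only [Fintype.card_sum, Fintype.card_prod, Fintype.card_fin]; linarith)
    (Sum.elim vc rc) (by
      rintro (x | x) (y | y) h
      · exact congrArg _ (hvc h)
      · exact absurd h (hvr _ _)
      · exact absurd h.symm (hvr _ _)
      · exact congrArg _ (hrc h))
    (Sum.elim (fun x q => Rd x.1 x.2 q) (fun _ _ => 0))
    (fun x q => Rd (s0 x.1) x.2 q - Rd (s1 x.1) x.2 q)
    (Sum.elim (fun _ _ => 0) (fun x y => if x = y then 1 else 0))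
  obtain ⟨f2, hf2, h2⟩ := ff_overwrite (n := n) (W := W)
    (κ := β × Fin dx) (ρ := (β × Fin dx) ⊕ (β × Fin dx))
    (by simp only [Fintype.card_sum, Fintype.card_prod, Fintype.card_fin]; nlinarith)
    vc hvc (fun x q => if q = vc (s2 x.1, x.2) then 1 else 0)
    (Sum.elim (fun x q => (if q = vc (s2 x.1, x.2) then 1 else 0) -
        (if q = vc (s1 x.1, x.2) then 1 else 0) - (if q = rc x then 1 else 0))
      (fun x q => (if q = vc (s0 x.1, x.2) then 1 else 0) - (if q = rc x then 1 else 0) -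
        (if q = vc (s2 x.1, x.2) then 1 else 0)))
    (fun x => Sum.elim (fun y => if x = y then -1 else 0) (fun y => if x = y then 1 else 0))
  refine ⟨f1, f2, fun b => Matrix.of fun i q => if q = vc (b, i) then 1 else 0, hf1, hf2, ?_⟩
  intro Z b i j
  have hv : ∀ x j, f1 Z (vc x) j = (Rd x.1 * Z) x.2 j := by
    intro x j
    have := h1 Z (Sum.inl x) j
    simpa [Matrix.mul_apply] using this
  have hr : ∀ x j, f1 Z (rc x) j = max ((Rd (s0 x.1) * Z) x.2 j - (Rd (s1 x.1) * Z) x.2 j) 0 := by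
    intro x j
    have := h1 Z (Sum.inr x) j
    simpa [Matrix.mul_apply, sub_mul] using this
  have h3 := h2 (f1 Z) (b, i) j
  simp only [Fintype.sum_sum_type, Sum.elim_inl, Sum.elim_inr, sub_mul, ite_mul, one_mul, zero_mul,
    Finset.sum_sub_distrib, Finset.sum_ite_eq', Finset.sum_ite_eq, Finset.mem_univ, if_true,
    hv, hr, neg_mul] at h3
  simp only [Matrix.mul_apply (M := Matrix.of _), Matrix.of_apply, ite_mul, one_mul, zero_mul,
    Finset.sum_ite_eq', Finset.mem_univ, if_true]
  rw [h3]
  generalize (Rd (s0 b) * Z) i j = x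
  generalize (Rd (s1 b) * Z) i j = y
  generalize (Rd (s2 b) * Z) i j = z
  unfold med3
  rcases le_total x y with h | h
  · rw [max_eq_right (sub_nonpos.2 h), max_eq_right h, min_eq_left h]; ring_nf
  · rw [max_eq_left (sub_nonneg.2 h), max_eq_left h, min_eq_right h]; ring_nf

/-- Block projection. -/
def blkP {D D' : ℕ} {β : Type} (c : β × Fin D → Fin D') (b : β) : Matrix (Fin D) (Fin D') ℝ :=
  Matrix.of fun i p => if p = c (b, i) then 1 else 0

theorem blkP_mul {D D' n : ℕ} {β : Type} (c : β × Fin D → Fin D') (b : β)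
    (Z : Matrix (Fin D') (Fin n) ℝ) (i j) : (blkP c b * Z) i j = Z (c (b, i)) j := by
  simp [blkP, Matrix.mul_apply]

theorem blkP_transpose {D D' : ℕ} {β : Type} [DecidableEq β] (c : β × Fin D → Fin D')
    (hc : Function.Injective c) (b b' : β) :
    blkP c b * (blkP c b')ᵀ = if b = b' then 1 else 0 := by
  ext i i'
  rw [blkP_mul]
  by_cases h : b = b'
  · subst h
    simp [blkP, hc.eq_iff, Matrix.one_apply]
  · simp [blkP, hc.eq_iff, h]

theorem blkP_sum {D D' n : ℕ} {β : Type} [Fintype β] (c : β × Fin D → Fin D')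
    (hc : Function.Injective c) (b : β) (Y : β → Matrix (Fin D) (Fin n) ℝ) :
    blkP c b * ∑ b', (blkP c b')ᵀ * Y b' = Y b := by
  classical
  rw [Matrix.mul_sum]
  rw [Finset.sum_eq_single b]
  · rw [← Matrix.mul_assoc, blkP_transpose c hc, if_pos rfl, Matrix.one_mul]
  · intro b' _ hb
    rw [← Matrix.mul_assoc, blkP_transpose c hc, if_neg hb.symm, Matrix.zero_mul]
  · simp

theorem sa_par {n D D' H H' S : ℕ} {β : Type} [Fintype β]
    (hH : Fintype.card β * H = H') (c : β × Fin D → Fin D') (hc : Function.Injective c)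
    {g : Matrix (Fin D) (Fin n) ℝ → Matrix (Fin D) (Fin n) ℝ} (hg : IsSelfAttn n D H S g) :
    ∃ g', IsSelfAttn n D' H' S g' ∧ ∀ Z b, blkP c b * g' Z = g (blkP c b * Z) := by
  obtain ⟨WV, WK, WQ, WO, h⟩ := hg
  have e : β × Fin H ≃ Fin H' := Fintype.equivFinOfCardEq (by simpa using hH)
  refine ⟨_, ⟨fun k => WV (e.symm k).2 * blkP c (e.symm k).1,
    fun k => WK (e.symm k).2 * blkP c (e.symm k).1,
    fun k => WQ (e.symm k).2 * blkP c (e.symm k).1,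
    fun k => (blkP c (e.symm k).1)ᵀ * WO (e.symm k).2, fun Z => rfl⟩, ?_⟩
  intro Z b
  rw [← e.sum_comp, Fintype.sum_prod_type, Matrix.mul_add, h]
  simp only [Equiv.symm_apply_apply, Matrix.mul_assoc]
  simp only [← Matrix.mul_sum]
  rw [blkP_sum c hc]

theorem ff_par {n D D' W W' : ℕ} {β : Type} [Fintype β]
    (hW : Fintype.card β * W ≤ W') (c : β × Fin D → Fin D') (hc : Function.Injective c)
    {g : Matrix (Fin D) (Fin n) ℝ → Matrix (Fin D) (Fin n) ℝ} (hg : IsFeedForward n D W g) :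
    ∃ g', IsFeedForward n D' W' g' ∧ ∀ Z b, blkP c b * g' Z = g (blkP c b * Z) := by
  classical
  obtain ⟨W1, W2, b1, b2, h⟩ := hg
  refine ⟨_, ff_of (ω := β × Fin W) (by simpa using hW)
    (fun x q => (W1 * blkP c x.1) x.2 q)
    (fun p x => ∑ i, if p = c (x.1, i) then W2 i x.2 else 0)
    (fun x => b1 x.2) (fun p => ∑ y : β × Fin D, if p = c y then b2 y.2 else 0), ?_⟩
  intro Z b
  ext i j
  rw [blkP_mul, h]
  have key : ∀ (b' : β) w, ∑ q, (W1 * blkP c b') w q * Z q j = (W1 * (blkP c b' * Z)) w j := by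
    intro b' w
    rw [← Matrix.mul_assoc, Matrix.mul_apply (M := W1 * _)]
  have h2 : ∀ (b' : β) w, (∑ i', if b = b' ∧ i = i' then W2 i' w else 0) =
      if b = b' then W2 i w else 0 := by
    intro b' w
    by_cases hb : b = b' <;> simp [hb]
  have h4 : (∑ y : β × Fin D, if (b, i) = y then b2 y.2 else 0) = b2 i := by simp
  simp only [Matrix.of_apply, hc.eq_iff, h4]
  simp only [key, Matrix.add_apply, Prod.mk.injEq, blkP_mul, h2, Fintype.sum_prod_type, ite_mul, zero_mul]
  rw [Finset.sum_comm]
  simp [Matrix.mul_apply (M := W2), reluM]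

theorem body_par {n dx D D' H H' S W W' : ℕ} {β : Type} [Fintype β]
    (hH : Fintype.card β * H = H') (hW : Fintype.card β * W ≤ W')
    (c : β × Fin D → Fin D') (hc : Function.Injective c)
    (sh : β → Matrix (Fin dx) (Fin n) ℝ)
    (Ain : Matrix (Fin D) (Fin dx) ℝ) (P : Matrix (Fin D) (Fin n) ℝ) (L : ℕ)
    (SA FF : Fin L → Matrix (Fin D) (Fin n) ℝ → Matrix (Fin D) (Fin n) ℝ)
    (h1 : ∀ l, IsSelfAttn n D H S (SA l)) (h2 : ∀ l, IsFeedForward n D W (FF l)) :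
    ∃ f, TBody n dx D' H' S W' L f ∧ ∀ X b, blkP c b * f X =
      Fin.foldl L (fun Z l => FF l (SA l Z)) (Ain * (X + sh b) + P) := by
  induction L with
  | zero =>
    refine ⟨_, TBody.zero (∑ b, (blkP c b)ᵀ * Ain) (∑ b, (blkP c b)ᵀ * (Ain * sh b + P)), ?_⟩
    intro X b
    rw [Matrix.sum_mul, Matrix.mul_add, blkP_sum c hc]
    simp only [Matrix.mul_assoc]
    rw [blkP_sum c hc]
    simp [Matrix.mul_add, add_assoc]
  | succ L ih =>
    obtain ⟨f, hf, hfX⟩ := ih (fun l => SA l.castSucc) (fun l => FF l.castSucc)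
      (fun l => h1 _) (fun l => h2 _)
    obtain ⟨g, hg, hgZ⟩ := sa_par hH c hc (h1 (Fin.last L))
    obtain ⟨k, hk, hkZ⟩ := ff_par hW c hc (h2 (Fin.last L))
    refine ⟨_, hf.succ hg hk, fun X b => ?_⟩
    rw [hkZ, hgZ, hfX, Fin.foldl_succ_last]

/-- Entrywise membership in the trifling intervals. -/
def badE (K : ℕ) (δ x : ℝ) : Prop :=
  ∃ t ∈ Finset.Icc 1 (K - 1), x ∈ Set.Ioo ((t : ℝ) / K) ((t : ℝ) / K + δ)

def goodE (K : ℕ) (δ x : ℝ) : Prop := x ∈ Set.Icc (0 : ℝ) 1 ∧ ¬ badE K δ x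

theorem badE_gap {K : ℕ} (hK : 0 < K) {δ : ℝ} (hδ : δ ∈ Set.Ioc (0 : ℝ) (1 / (3 * K)))
    {x y : ℝ} (hx : badE K δ x) (hy : badE K δ y) (h1 : x + δ ≤ y) : x + 2 * δ < y := by
  obtain ⟨t, ht, hx1, hx2⟩ := hx
  obtain ⟨s, hs, hy1, hy2⟩ := hy
  have hKr : (0 : ℝ) < K := by exact_mod_cast hK
  have h3 : 3 * δ ≤ 1 / K := by
    have := hδ.2
    rw [le_div_iff₀ (by positivity)] at this ⊢
    linarith
  have hts : t < s := by
    by_contra hh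
    have : (s : ℝ) / K ≤ t / K := by
      gcongr
      omega
    linarith
  have : (t : ℝ) / K + 1 / K ≤ s / K := by
    rw [← add_div]
    gcongr
    exact_mod_cast hts
  linarith

theorem badE_bounds {K : ℕ} (hK : 0 < K) {δ : ℝ} (hδ : δ ∈ Set.Ioc (0 : ℝ) (1 / (3 * K)))
    {x : ℝ} (hx : badE K δ x) : 3 * δ < x ∧ x < 1 - 2 * δ := by
  obtain ⟨t, ht, hx1, hx2⟩ := hx
  have hKr : (0 : ℝ) < K := by exact_mod_cast hK
  have h3 : 3 * δ ≤ 1 / K := by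
    have := hδ.2
    rw [le_div_iff₀ (by positivity)] at this ⊢
    linarith
  rw [Finset.mem_Icc] at ht
  have h4 : (1 : ℝ) / K ≤ t / K := by
    gcongr
    exact_mod_cast ht.1
  have h5 : (t : ℝ) / K + 1 / K ≤ 1 := by
    rw [← add_div, div_le_one hKr]
    have : t + 1 ≤ K := by omega
    exact_mod_cast this
  constructor <;> linarith

theorem two_good {K : ℕ} (hK : 0 < K) {δ : ℝ} (hδ : δ ∈ Set.Ioc (0 : ℝ) (1 / (3 * K)))
    {x : ℝ} (hx : x ∈ Set.Icc (0 : ℝ) 1) :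
    (goodE K δ (x - δ) ∧ goodE K δ x) ∨ (goodE K δ (x - δ) ∧ goodE K δ (x + δ)) ∨
      (goodE K δ x ∧ goodE K δ (x + δ)) := by
  have hδ0 := hδ.1
  have hKr : (1 : ℝ) ≤ K := by exact_mod_cast hK
  have h3 : 3 * δ ≤ 1 := by
    have := hδ.2
    rw [le_div_iff₀ (by positivity)] at this
    nlinarith
  obtain ⟨hx0, hx1⟩ := hx
  have hb : ∀ {y}, badE K δ y → 3 * δ < y ∧ y < 1 - 2 * δ := fun h => badE_bounds hK hδ h
  by_cases c1 : x < δ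
  · right; right
    exact ⟨⟨⟨hx0, hx1⟩, fun h => by linarith [hb h]⟩,
      ⟨⟨by linarith, by linarith⟩, fun h => by linarith [hb h]⟩⟩
  by_cases c2 : 1 - δ < x
  · left
    exact ⟨⟨⟨by linarith, by linarith⟩, fun h => by linarith [hb h]⟩,
      ⟨⟨hx0, hx1⟩, fun h => by linarith [hb h]⟩⟩
  push Not at c1 c2
  have i1 : x - δ ∈ Set.Icc (0 : ℝ) 1 := ⟨by linarith, by linarith⟩
  have i2 : x ∈ Set.Icc (0 : ℝ) 1 := ⟨by linarith, by linarith⟩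
  have i3 : x + δ ∈ Set.Icc (0 : ℝ) 1 := ⟨by linarith, by linarith⟩
  by_cases b1 : badE K δ (x - δ)
  · right; right
    exact ⟨⟨i2, fun h => by linarith [badE_gap hK hδ b1 h (by linarith)]⟩,
      ⟨i3, fun h => by linarith [badE_gap hK hδ b1 h (by linarith)]⟩⟩
  by_cases b2 : badE K δ x
  · right; left
    exact ⟨⟨i1, b1⟩, ⟨i3, fun h => by linarith [badE_gap hK hδ b2 h (by linarith)]⟩⟩
  exact Or.inl ⟨⟨i1, b1⟩, ⟨i2, b2⟩⟩

theorem frob_single {d n : ℕ} (A : Matrix (Fin d) (Fin n) ℝ) (i0 : Fin d) (j0 : Fin n) {δ : ℝ}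
    (hδ : 0 ≤ δ) (h0 : ∀ i j, (i, j) ≠ (i0, j0) → A i j = 0) (h1 : |A i0 j0| ≤ δ) :
    frobNorm A ≤ δ := by
  unfold frobNorm
  have : ∑ i, ∑ j, (A i j) ^ 2 = (A i0 j0) ^ 2 := by
    rw [← Fintype.sum_prod_type' (f := fun i j => (A i j) ^ 2),
      Finset.sum_eq_single (i0, j0)]
    · rintro ⟨i, j⟩ _ h
      simp [h0 i j h]
    · simp
  rw [this, Real.sqrt_sq_eq_abs]
  exact h1

/-- The shift of block `b`, restricted to the coordinates of index at least `k`. -/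
def shiftM (dx n : ℕ) (δ : ℝ) (k : ℕ) (b : Fin (dx * n) → Fin 3) : Matrix (Fin dx) (Fin n) ℝ :=
  Matrix.of fun i j => if k ≤ (finProdFinEquiv (i, j) : Fin (dx * n)).val then
    δ * (((b (finProdFinEquiv (i, j))).val : ℝ) - 1) else 0

theorem shiftM_upd_ne {dx n : ℕ} (δ : ℝ) {k : ℕ} (hk : k < dx * n) (b : Fin (dx * n) → Fin 3)
    (t : Fin 3) (i j) (h : (finProdFinEquiv (i, j) : Fin (dx * n)) ≠ ⟨k, hk⟩) :
    shiftM dx n δ k (Function.update b ⟨k, hk⟩ t) i j = shiftM dx n δ (k + 1) b i j := by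
  have h' : (finProdFinEquiv (i, j) : Fin (dx * n)).val ≠ k := fun e => h (Fin.ext e)
  unfold shiftM
  simp only [Matrix.of_apply, Function.update_of_ne h]
  by_cases h2 : k ≤ (finProdFinEquiv (i, j) : Fin (dx * n)).val
  · rw [if_pos h2, if_pos (by omega)]
  · rw [if_neg h2, if_neg (by omega)]

theorem shiftM_upd_eq {dx n : ℕ} (δ : ℝ) {k : ℕ} (hk : k < dx * n) (b : Fin (dx * n) → Fin 3)
    (t : Fin 3) (i j) (h : (finProdFinEquiv (i, j) : Fin (dx * n)) = ⟨k, hk⟩) :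
    shiftM dx n δ k (Function.update b ⟨k, hk⟩ t) i j = δ * ((t.val : ℝ) - 1) ∧
    shiftM dx n δ (k + 1) b i j = 0 := by
  unfold shiftM
  simp only [Matrix.of_apply, h]
  simp

/-- Proposition 3: upgrading approximation outside the trifling region to
uniform approximation on the whole cube, by a moderately larger transformer. -/
theorem transformer_remove_trifling
    (dx n : ℕ) (hdx : 0 < dx) (hn : 0 < n) (γ KH : ℝ)
    (hγ : γ ∈ Set.Ioc (0 : ℝ) 1) (hKH : 0 < KH)
    (F : Matrix (Fin dx) (Fin n) ℝ → Matrix (Fin dx) (Fin n) ℝ)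
    (hF : ∀ i j, HolderClass γ KH (unitCube dx n) (fun X => F X i j))
    (ε : ℝ) (hε : 0 < ε) (K : ℕ) (hK : 0 < K) (δ : ℝ)
    (hδ : δ ∈ Set.Ioc (0 : ℝ) (1 / (3 * K)))
    (D H S W L : ℕ)
    (Nt : Matrix (Fin dx) (Fin n) ℝ → Matrix (Fin dx) (Fin n) ℝ)
    (hNt : IsTransformer n dx dx D H S W L Nt)
    (hNtF : ∀ i j, ∀ X ∈ unitCube dx n \ trifling dx n K δ, |Nt X i j - F X i j| ≤ ε) :
    ∃ N : Matrix (Fin dx) (Fin n) ℝ → Matrix (Fin dx) (Fin n) ℝ,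
      IsTransformer n dx dx (3 ^ (dx * n) * max D (5 * dx)) (3 ^ (dx * n) * H) S
        (3 ^ (dx * n) * max W (14 * dx)) (L + 2 * dx * n) N ∧
      ∀ i j, ∀ X ∈ unitCube dx n,
        |N X i j - F X i j| ≤ ε + (dx : ℝ) * n * KH * δ ^ γ := by
  have hcard : Fintype.card (Fin (dx * n) → Fin 3) = 3 ^ (dx * n) := by simp
  let e : (Fin (dx * n) → Fin 3) × Fin (max D (5 * dx)) ≃ Fin (3 ^ (dx * n) * max D (5 * dx)) :=
    Fintype.equivFinOfCardEq (by simp)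
  -- the Hölder modulus
  have hmod : ∀ i j, ∀ X ∈ unitCube dx n, ∀ Y ∈ unitCube dx n, frobNorm (X - Y) ≤ δ →
      |F X i j - F Y i j| ≤ KH * δ ^ γ := by
    intro i j X hX Y hY h
    obtain ⟨C1, C2, hC1, hC2, hC, -, hh⟩ := hF i j
    refine (hh X hX Y hY).trans ?_
    have h0 : 0 ≤ frobNorm (X - Y) := Real.sqrt_nonneg _
    have : frobNorm (X - Y) ^ γ ≤ δ ^ γ := Real.rpow_le_rpow h0 h hγ.1.le
    exact mul_le_mul (by linarith) this (Real.rpow_nonneg h0 _) hKH.le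
  have main : ∀ k, k ≤ dx * n → ∃ f, TBody n dx (3 ^ (dx * n) * max D (5 * dx))
      (3 ^ (dx * n) * H) S (3 ^ (dx * n) * max W (14 * dx)) (L + 2 * k) f ∧
      ∃ Rd : (Fin (dx * n) → Fin 3) → Matrix (Fin dx) (Fin (3 ^ (dx * n) * max D (5 * dx))) ℝ,
      ∀ X b, X + shiftM dx n δ k b ∈ unitCube dx n →
        (∀ i j, k ≤ (finProdFinEquiv (i, j) : Fin (dx * n)).val →
          ¬ badE K δ ((X + shiftM dx n δ k b) i j)) →
        ∀ i j, |(Rd b * f X) i j - F (X + shiftM dx n δ k b) i j| ≤ ε + k * (KH * δ ^ γ) := by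
    intro k
    induction k with
    | zero =>
      intro _
      obtain ⟨Ain, P, Aout, SA, FF, h1, h2, h3⟩ := hNt
      let c : (Fin (dx * n) → Fin 3) × Fin D → Fin (3 ^ (dx * n) * max D (5 * dx)) :=
        fun x => e (x.1, Fin.castLE (le_max_left _ _) x.2)
      have hc : Function.Injective c := by
        rintro ⟨b, i⟩ ⟨b', i'⟩ h
        have := e.injective h
        simp only [Prod.mk.injEq] at this
        exact Prod.ext this.1 (Fin.castLE_injective _ this.2)
      obtain ⟨f, hf, hfX⟩ := body_par (S := S) (W' := 3 ^ (dx * n) * max W (14 * dx))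
        (H' := 3 ^ (dx * n) * H) (by rw [hcard])
        (by rw [hcard]; exact Nat.mul_le_mul_left _ (le_max_left _ _)) c hc
        (fun b => shiftM dx n δ 0 b) Ain P L SA FF h1 h2
      refine ⟨f, hf, fun b => Aout * blkP c b, ?_⟩
      intro X b hX hb i j
      rw [Matrix.mul_assoc, hfX, ← h3]
      have := hNtF i j _ ⟨hX, fun ht => ?_⟩
      · simpa using this
      · obtain ⟨-, i', j', ht⟩ := ht
        exact hb i' j' (Nat.zero_le _) ht
    | succ k ih =>
      intro hk
      obtain ⟨f, hf, Rd, hR⟩ := ih (by omega)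
      obtain ⟨f1, f2, Rd', hf1, hf2, hmed⟩ := level_layers (n := n)
        (M := max D (5 * dx)) (W := 3 ^ (dx * n) * max W (14 * dx))
        (le_trans (by omega) (le_max_right D (5 * dx)))
        (by
          rw [hcard]
          exact Nat.mul_le_mul_left _ (le_trans (by omega) (le_max_right W (14 * dx))))
        e e.injective Rd (fun b => Function.update b ⟨k, hk⟩ 0)
        (fun b => Function.update b ⟨k, hk⟩ 1) (fun b => Function.update b ⟨k, hk⟩ 2)
      refine ⟨_, (hf.succ (isSelfAttn_id _ _ _ _) hf1).succ (isSelfAttn_id _ _ _ _) hf2, Rd', ?_⟩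
      intro X b hX hb i j
      rw [hmed]
      -- the distinguished coordinate
      obtain ⟨⟨i0, j0⟩, hij⟩ := (finProdFinEquiv (m := dx) (n := n)).surjective ⟨k, hk⟩
      have hne : ∀ i j, (i, j) ≠ (i0, j0) →
          (finProdFinEquiv (i, j) : Fin (dx * n)) ≠ ⟨k, hk⟩ := by
        intro i j h h'
        exact h (finProdFinEquiv.injective (h'.trans hij.symm))
      have step : ∀ t : Fin 3, goodE K δ ((X + shiftM dx n δ (k + 1) b) i0 j0 +
          δ * ((t.val : ℝ) - 1)) →
          |(Rd (Function.update b ⟨k, hk⟩ t) * f X) i j - F (X + shiftM dx n δ (k + 1) b) i j| ≤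
            ε + ((k + 1 : ℕ) : ℝ) * (KH * δ ^ γ) := by
        intro t hg
        have he0 := shiftM_upd_eq δ hk b t i0 j0 hij
        have hval : (X + shiftM dx n δ k (Function.update b ⟨k, hk⟩ t)) i0 j0 =
            (X + shiftM dx n δ (k + 1) b) i0 j0 + δ * ((t.val : ℝ) - 1) := by
          simp [Matrix.add_apply, he0.1, he0.2]
        have hval' : ∀ i j, (i, j) ≠ (i0, j0) →
            (X + shiftM dx n δ k (Function.update b ⟨k, hk⟩ t)) i j =
            (X + shiftM dx n δ (k + 1) b) i j := by
          intro i j h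
          simp [Matrix.add_apply, shiftM_upd_ne δ hk b t i j (hne i j h)]
        have hcube : X + shiftM dx n δ k (Function.update b ⟨k, hk⟩ t) ∈ unitCube dx n := by
          intro i j
          by_cases h : (i, j) = (i0, j0)
          · obtain ⟨rfl, rfl⟩ := Prod.mk.inj h
            rw [hval]; exact hg.1
          · rw [hval' i j h]; exact hX i j
        have h1 := hR X (Function.update b ⟨k, hk⟩ t) hcube (by
          intro i j hki
          by_cases h : (i, j) = (i0, j0)
          · obtain ⟨rfl, rfl⟩ := Prod.mk.inj h
            rw [hval]; exact hg.2
          · rw [hval' i j h]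
            refine hb i j ?_
            have : (finProdFinEquiv (i, j) : Fin (dx * n)).val ≠ k :=
              fun e => hne i j h (Fin.ext e)
            omega) i j
        have h2 := hmod i j _ hcube _ hX (frob_single _ i0 j0 hδ.1.le (by
          intro i j h
          rw [Matrix.sub_apply, hval' i j h, sub_self]) (by
          rw [Matrix.sub_apply, hval, add_sub_cancel_left, abs_mul, abs_of_pos hδ.1]
          have : |((t.val : ℝ) - 1)| ≤ 1 := by
            fin_cases t <;> norm_num
          nlinarith [hδ.1]))
        have h3 := abs_sub_le ((Rd (Function.update b ⟨k, hk⟩ t) * f X) i j)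
          (F (X + shiftM dx n δ k (Function.update b ⟨k, hk⟩ t)) i j)
          (F (X + shiftM dx n δ (k + 1) b) i j)
        push_cast
        linarith
      have s0 := step 0
      have s1 := step 1
      have s2 := step 2
      have e0 : ∀ x : ℝ, x + δ * ((((0 : Fin 3).val : ℕ) : ℝ) - 1) = x - δ := by
        intro x; simp; ring
      have e1 : ∀ x : ℝ, x + δ * ((((1 : Fin 3).val : ℕ) : ℝ) - 1) = x := by
        intro x; simp
      have e2 : ∀ x : ℝ, x + δ * ((((2 : Fin 3).val : ℕ) : ℝ) - 1) = x + δ := by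
        intro x; simp; norm_num
      rw [e0] at s0
      rw [e1] at s1
      rw [e2] at s2
      apply med3_near
      rcases two_good hK hδ (hX i0 j0) with ⟨h1, h2⟩ | ⟨h1, h2⟩ | ⟨h1, h2⟩
      · exact Or.inl ⟨s0 h1, s1 h2⟩
      · exact Or.inr (Or.inl ⟨s0 h1, s2 h2⟩)
      · exact Or.inr (Or.inr ⟨s1 h1, s2 h2⟩)
  obtain ⟨f, hf, Rd, hR⟩ := main (dx * n) le_rfl
  have hL : L + 2 * (dx * n) = L + 2 * dx * n := by ring
  rw [hL] at hf
  obtain ⟨Ain, P, SA, FF, h1, h2, h3⟩ := hf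
  refine ⟨fun X => Rd (fun _ => 0) * f X,
    ⟨Ain, P, Rd (fun _ => 0), SA, FF, h1, h2, fun X => by simp only [h3]⟩, ?_⟩
  intro i j X hX
  have hz : X + shiftM dx n δ (dx * n) (fun _ => 0) = X := by
    ext i j
    have := (finProdFinEquiv (i, j) : Fin (dx * n)).isLt
    simp only [Matrix.add_apply, shiftM, Matrix.of_apply]
    rw [if_neg (by omega), add_zero]
  have := hR X (fun _ => 0) (by rw [hz]; exact hX) (by
    intro i j h
    have := (finProdFinEquiv (i, j) : Fin (dx * n)).isLt
    omega) i j
  rw [hz] at this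
  refine this.trans (le_of_eq ?_)
  push_cast
  ring
end

section
/- Let d_x, d_y, n ∈ ℕ and let N: ℝ^{d_x} → ℝ^{d_y} be a ReLU feed-forward neural network of width W ≥ max{d_x, d_y} and depth L ≥ 2. Then there exist an embedding map E_in: ℝ^{d_x×n} → ℝ^{W×n} sending X to X padded below with W − d_x zero rows, a projection map E_out: ℝ^{W×n} → ℝ^{d_y×n} extracting the first d_y rows, and L feed-forward layers F_1, …, F_L on ℝ^{W×n}, each with hidden dimension at most 3W, such that for every X ∈ ℝ^{d_x×n}, E_out(F_L(⋯F_1(E_in(X))⋯)) = (N(X_{:,1}), …, N(X_{:,n})) ∈ ℝ^{d_y×n}, i.e., the composition applies N column-wise. -/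
open MeasureTheory Matrix

/-- Hidden layers of a ReLU FNN: `fnnHidden A0 b0 A b l x` is `N_{l+1}(x)`, i.e.
`l + 1` applications of `relu(A·(-) + b)` to `x` (first with `A0, b0`). -/
noncomputable def fnnHidden {dx W : ℕ} (A0 : Matrix (Fin W) (Fin dx) ℝ) (b0 : Fin W → ℝ)
    (A : ℕ → Matrix (Fin W) (Fin W) ℝ) (b : ℕ → Fin W → ℝ) :
    ℕ → (Fin dx → ℝ) → Fin W → ℝ
  | 0, x => fun i => max (A0.mulVec x i + b0 i) 0
  | l + 1, x => fun i =>
      max ((A (l + 1)).mulVec (fnnHidden A0 b0 A b l x) i + b (l + 1) i) 0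

/-- `N : ℝ^{dx} → ℝ^{dy}` is a ReLU feed-forward network of width `W` and depth `L ≥ 1`:
`N_0(x) = x`, `N_{l+1}(x) = σ_R(A_l N_l(x) + b_l)` for `l = 0,…,L-1`, and
`N(x) = A_L N_L(x) + b_L`. -/
def IsFNN (dx dy W L : ℕ) (N : (Fin dx → ℝ) → Fin dy → ℝ) : Prop :=
  ∃ (A0 : Matrix (Fin W) (Fin dx) ℝ) (b0 : Fin W → ℝ)
    (A : ℕ → Matrix (Fin W) (Fin W) ℝ) (b : ℕ → Fin W → ℝ)
    (AL : Matrix (Fin dy) (Fin W) ℝ) (bL : Fin dy → ℝ),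
    ∀ x, N x = fun i => AL.mulVec (fnnHidden A0 b0 A b (L - 1) x) i + bL i

/-- The residual connection can be cancelled with `2W` extra hidden units. -/
theorem ff_no_residual (n W : ℕ) (B A : Matrix (Fin W) (Fin W) ℝ) (c b : Fin W → ℝ) :
    IsFeedForward n W (3 * W)
      (fun Z => A * reluM (B * Z + Matrix.of fun i _ => c i) + Matrix.of fun i _ => b i) := by
  have hcard : Fintype.card (Fin W ⊕ (Fin W ⊕ Fin W)) = 3 * W := by
    simp; ring
  let e : (Fin W ⊕ (Fin W ⊕ Fin W)) ≃ Fin (3 * W) := Fintype.equivFinOfCardEq hcard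
  refine ⟨Matrix.of fun k s => Sum.elim (fun r => B r s)
      (Sum.elim (fun r => (1 : Matrix (Fin W) (Fin W) ℝ) r s)
      (fun r => (-1 : Matrix (Fin W) (Fin W) ℝ) r s)) (e.symm k),
    Matrix.of fun i k => Sum.elim (fun r => A i r) (Sum.elim (fun r => (-1 : Matrix (Fin W) (Fin W) ℝ) i r)
      (fun r => (1 : Matrix (Fin W) (Fin W) ℝ) i r)) (e.symm k),
    fun k => Sum.elim c (fun _ => 0) (e.symm k), b, ?_⟩
  intro Z
  ext i j
  simp only [Matrix.add_apply, Matrix.mul_apply, Matrix.of_apply, reluM]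
  rw [← e.sum_comp]
  simp only [Equiv.symm_apply_apply, Fintype.sum_sum_type, Sum.elim_inl, Sum.elim_inr, add_zero]
  have h1 : ∀ x, ∑ k, (1 : Matrix (Fin W) (Fin W) ℝ) x k * Z k j = Z x j := by
    intro x; rw [← Matrix.mul_apply, Matrix.one_mul]
  have h2 : ∀ x, ∑ k, (-1 : Matrix (Fin W) (Fin W) ℝ) x k * Z k j = -Z x j := by
    intro x; rw [← Matrix.mul_apply, Matrix.neg_mul, Matrix.one_mul]; rfl
  simp only [h1, h2]
  have h3 : ∀ v : Fin W → ℝ, ∑ k, (1 : Matrix (Fin W) (Fin W) ℝ) i k * v k = v i := by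
    intro v; exact congrFun (Matrix.one_mulVec v) i
  have h4 : ∀ v : Fin W → ℝ, ∑ k, (-1 : Matrix (Fin W) (Fin W) ℝ) i k * v k = -v i := by
    intro v; simp only [Matrix.neg_apply, neg_mul, Finset.sum_neg_distrib, h3]
  rw [h3 (fun x => max (-Z x j) 0), h4 (fun x => max (Z x j) 0)]
  have h5 : max (Z i j) 0 - max (-Z i j) 0 = Z i j := by
    rcases le_total (Z i j) 0 with h | h
    · rw [max_eq_right h, max_eq_left (by linarith)]; ring
    · rw [max_eq_left h, max_eq_right (by linarith)]; ring
  linarith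

/-- Lemma 10: any token-wise ReLU FNN of width `W ≥ max{dx, dy}` and depth
`L ≥ 2` can be represented by `L` feed-forward (residual) layers of hidden dimension at most
`3W`, together with the zero-padding embedding and the first-rows projection. -/
theorem fnn_as_feedforward_layers
    (dx dy n W L : ℕ) (hW : max dx dy ≤ W) (hL : 2 ≤ L)
    (N : (Fin dx → ℝ) → Fin dy → ℝ) (hN : IsFNN dx dy W L N) :
    ∃ FF : Fin L → Matrix (Fin W) (Fin n) ℝ → Matrix (Fin W) (Fin n) ℝ,
      (∀ l, ∃ W' ≤ 3 * W, IsFeedForward n W W' (FF l)) ∧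
      ∀ X : Matrix (Fin dx) (Fin n) ℝ,
        (Matrix.of fun (i : Fin dy) (j : Fin n) =>
            Fin.foldl L (fun Z l => FF l Z)
              (Matrix.of fun (i' : Fin W) j' =>
                if h : (i' : ℕ) < dx then X ⟨i', h⟩ j' else 0)
              (Fin.castLE (le_trans (le_max_right dx dy) hW) i) j)
          = Matrix.of fun (i : Fin dy) (j : Fin n) => N (fun k => X k j) i := by
  obtain ⟨A0, b0, A, b, AL, bL, hN⟩ := hN
  obtain ⟨M, rfl⟩ : ∃ M, L = M + 2 := ⟨L - 2, by omega⟩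
  have hdx : dx ≤ W := le_trans (le_max_left dx dy) hW
  have hdy : dy ≤ W := le_trans (le_max_right dx dy) hW
  let B : ℕ → Matrix (Fin W) (Fin W) ℝ := fun k =>
    if k = 0 then Matrix.of fun i i' => if h : (i' : ℕ) < dx then A0 i ⟨i', h⟩ else 0 else A k
  let c : ℕ → Fin W → ℝ := fun k => if k = 0 then b0 else b k
  let P : Matrix (Fin W) (Fin W) ℝ :=
    Matrix.of fun i i' => if h : (i : ℕ) < dy then AL ⟨i, h⟩ i' else 0
  let q : Fin W → ℝ := fun i => if h : (i : ℕ) < dy then bL ⟨i, h⟩ else 0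
  let G : Matrix (Fin W) (Fin W) ℝ → (Fin W → ℝ) → ℕ → Matrix (Fin W) (Fin n) ℝ →
      Matrix (Fin W) (Fin n) ℝ := fun Q r k Z =>
    Q * reluM (B k * Z + Matrix.of fun i _ => c k i) + Matrix.of fun i _ => r i
  refine ⟨fun l => if (l : ℕ) = M + 1 then G P q l else G 1 0 l, ?_, ?_⟩
  · intro l
    refine ⟨3 * W, le_rfl, ?_⟩
    dsimp only
    split_ifs
    · exact ff_no_residual n W _ _ _ _
    · exact ff_no_residual n W _ _ _ _
  · intro X
    have key : ∀ m : ℕ, Fin.foldl (m + 1) (fun Z (l : Fin (m + 1)) => G 1 0 l Z)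
        (Matrix.of fun (i' : Fin W) j' => if h : (i' : ℕ) < dx then X ⟨i', h⟩ j' else 0)
        = Matrix.of fun i j => fnnHidden A0 b0 A b m (fun k => X k j) i := by
      intro m
      induction m with
      | zero =>
        rw [Fin.foldl_succ_last, Fin.foldl_zero]
        ext i j
        simp only [G, Matrix.one_mul]
        simp only [B, c, reluM, Fin.val_last, if_true, Matrix.add_apply,
          Matrix.of_apply, Pi.zero_apply, add_zero, Matrix.mul_apply, fnnHidden, Matrix.mulVec,
          dotProduct]
        congr 2
        symm
        refine Finset.sum_of_injOn (Fin.castLE hdx) (by simp [Set.InjOn]) (by simp) ?_ ?_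
        · intro k _ hk
          have : ¬ (k : ℕ) < dx := by
            intro h
            apply hk
            exact ⟨⟨k, h⟩, by simp, by ext; simp⟩
          simp [this]
        · intro k _
          simp
      | succ m ih =>
        rw [Fin.foldl_succ_last]
        simp only [Fin.val_castSucc]
        rw [ih]
        ext i j
        simp only [G, Matrix.one_mul]
        simp [B, c, reluM, Matrix.mul_apply, fnnHidden, Matrix.mulVec, dotProduct]
    rw [Fin.foldl_succ_last]
    have hne : ∀ l : Fin (M + 1), ((l.castSucc : Fin (M + 2)) : ℕ) ≠ M + 1 := by
      intro l
      have := l.2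
      simp only [Fin.val_castSucc]
      omega
    simp only [hne, if_false, Fin.val_last, if_true]
    simp only [Fin.val_castSucc]
    rw [key M]
    ext i j
    simp [hN, G, B, c, P, q, reluM, Matrix.mul_apply, fnnHidden, Matrix.mulVec, dotProduct]
end

section
/- Let d_x, d_y, r ∈ ℕ with d_x ≥ d_y, and let (x_i, y_i), i = 1, …, r, be pairs with x_i ∈ ℝ^{d_x}, y_i ∈ ℝ^{d_y}, and x_i ≠ x_j whenever i ≠ j. Then there exists a single-token feed-forward layer F: ℝ^{d_x} → ℝ^{d_x}, F(x) = x + W2 σ_R(W1 x + b1) + b2, with hidden dimension at most 3r + 2 d_x, such that F(x_i) equals the vector y_i padded with d_x − d_y zeros for every i ∈ [r], and ‖F(z)‖₂ ≤ max_{i∈[r]} ‖y_i‖₂ for every z ∈ ℝ^{d_x}. -/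
noncomputable section

/-- The Euclidean norm of a vector in `ℝ^d`. -/
noncomputable def eucNorm {d : ℕ} (v : Fin d → ℝ) : ℝ :=
  Real.sqrt (∑ i, (v i) ^ 2)

/-- The hat function of half-width `δ`, as a combination of three ReLUs. -/
noncomputable def hatFn (δ a t : ℝ) : ℝ :=
  δ⁻¹ * max (t - a + δ) 0 + (-2 * δ⁻¹) * max (t - a) 0 + δ⁻¹ * max (t - a - δ) 0

theorem hatFn_self {δ : ℝ} (hδ : 0 < δ) (a : ℝ) : hatFn δ a a = 1 := by
  unfold hatFn
  have h1 : max (a - a + δ) 0 = δ := by rw [max_eq_left] <;> linarith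
  have h2 : max (a - a) 0 = 0 := by simp
  have h3 : max (a - a - δ) 0 = 0 := by rw [max_eq_right]; linarith
  rw [h1, h2, h3]; field_simp; ring

theorem hatFn_zero {δ : ℝ} (hδ : 0 < δ) (a t : ℝ) (h : δ ≤ |t - a|) : hatFn δ a t = 0 := by
  unfold hatFn
  rcases le_abs.1 h with h | h
  · rw [max_eq_left (by linarith), max_eq_left (by linarith), max_eq_left (by linarith)]; ring
  · rw [max_eq_right (by linarith), max_eq_right (by linarith), max_eq_right (by linarith)]; ring

theorem hatFn_mem {δ : ℝ} (hδ : 0 < δ) (a t : ℝ) : 0 ≤ hatFn δ a t ∧ hatFn δ a t ≤ 1 := by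
  by_cases h : δ ≤ |t - a|
  · rw [hatFn_zero hδ a t h]; norm_num
  push Not at h
  rw [abs_lt] at h
  unfold hatFn
  rw [max_eq_left (a := t - a + δ) (by linarith), max_eq_right (a := t - a - δ) (by linarith)]
  have hi : 0 < δ⁻¹ := inv_pos.2 hδ
  have hm : δ⁻¹ * δ = 1 := inv_mul_cancel₀ hδ.ne'
  rcases le_total (t - a) 0 with h0 | h0
  · rw [max_eq_right h0]
    constructor <;> nlinarith
  · rw [max_eq_left h0]
    constructor <;> nlinarith

theorem exists_sep (dx r : ℕ) (x : Fin r → Fin dx → ℝ)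
    (hx : ∀ i j : Fin r, i ≠ j → x i ≠ x j) :
    ∃ v : Fin dx → ℝ, ∀ i j : Fin r, i ≠ j → v ⬝ᵥ x i ≠ v ⬝ᵥ x j := by
  classical
  let p : Fin r → Fin r → Polynomial ℝ := fun i j =>
    ∑ k : Fin dx, Polynomial.C (x i k - x j k) * Polynomial.X ^ (k : ℕ)
  have hp : ∀ i j, i ≠ j → p i j ≠ 0 := by
    intro i j hij h0
    apply hx i j hij
    funext k
    have := congrArg (fun q => Polynomial.coeff q (k : ℕ)) h0
    simp only [p, Polynomial.finset_sum_coeff, Polynomial.coeff_C_mul, Polynomial.coeff_X_pow,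
      Polynomial.coeff_zero, mul_ite, mul_one, mul_zero, Fin.val_inj] at this
    simp at this
    linarith
  let Q : Polynomial ℝ := ∏ i, ∏ j, if i = j then 1 else p i j
  have hQ : Q ≠ 0 := by
    refine Finset.prod_ne_zero_iff.2 fun i _ => Finset.prod_ne_zero_iff.2 fun j _ => ?_
    split_ifs with h
    · exact one_ne_zero
    · exact hp i j h
  obtain ⟨t, ht⟩ : ∃ t, Q.eval t ≠ 0 := by
    by_contra! h
    exact hQ (Polynomial.funext (by simpa using h))
  refine ⟨fun k => t ^ (k : ℕ), fun i j hij he => ht ?_⟩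
  simp only [Q, Polynomial.eval_prod]
  refine Finset.prod_eq_zero (Finset.mem_univ i) (Finset.prod_eq_zero (Finset.mem_univ j) ?_)
  rw [if_neg hij]
  simp only [p, Polynomial.eval_finset_sum, Polynomial.eval_mul, Polynomial.eval_C,
    Polynomial.eval_pow, Polynomial.eval_X, sub_mul, Finset.sum_sub_distrib]
  simp only [dotProduct, mul_comm (t ^ _)] at he
  linarith

theorem exists_gap (r : ℕ) (a : Fin r → ℝ) (ha : ∀ i j, i ≠ j → a i ≠ a j) :
    ∃ δ : ℝ, 0 < δ ∧ ∀ i j, i ≠ j → 2 * δ ≤ |a i - a j| := by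
  have h : ∀ᶠ δ : ℝ in nhdsWithin 0 (Set.Ioi 0), 0 < δ ∧ ∀ i j, i ≠ j → 2 * δ ≤ |a i - a j| := by
    refine Filter.Eventually.and self_mem_nhdsWithin ?_
    refine Filter.eventually_all.2 fun i => Filter.eventually_all.2 fun j => ?_
    by_cases hij : i = j
    · simp [hij]
    have hpos : 0 < |a i - a j| / 2 := by
      have := abs_pos.2 (sub_ne_zero.2 (ha i j hij)); linarith
    filter_upwards [Ioo_mem_nhdsGT hpos] with δ hδ _
    have := hδ.2
    linarith
  exact h.exists

/-- `y` padded with zeros. -/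
noncomputable def padV {dx dy : ℕ} (y : Fin dy → ℝ) : Fin dx → ℝ :=
  fun k => if h : (k : ℕ) < dy then y ⟨k, h⟩ else 0

theorem eucNorm_padV {dx dy : ℕ} (hd : dy ≤ dx) (y : Fin dy → ℝ) :
    eucNorm (padV y : Fin dx → ℝ) = eucNorm y := by
  obtain ⟨k, rfl⟩ := Nat.exists_eq_add_of_le hd
  unfold eucNorm padV
  rw [Fin.sum_univ_add]
  simp

theorem eucNorm_smul_le {d : ℕ} (c : ℝ) (h0 : 0 ≤ c) (h1 : c ≤ 1) (v : Fin d → ℝ) :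
    eucNorm (c • v) ≤ eucNorm v := by
  unfold eucNorm
  apply Real.sqrt_le_sqrt
  apply Finset.sum_le_sum
  intro i _
  simp only [Pi.smul_apply, smul_eq_mul, mul_pow]
  have : c ^ 2 ≤ 1 := pow_le_one₀ h0 h1
  nlinarith [sq_nonneg (v i)]

/-- The layer with an arbitrary finite index type for hidden units. -/
theorem layer_exists (dx r : ℕ) (v : Fin dx → ℝ) (δ : ℝ) (a : Fin r → ℝ)
    (Y : Fin r → Fin dx → ℝ) :
    ∃ (W1 : Matrix (Fin (3 * r + 2 * dx)) (Fin dx) ℝ)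
      (W2 : Matrix (Fin dx) (Fin (3 * r + 2 * dx)) ℝ)
      (b1 : Fin (3 * r + 2 * dx) → ℝ), ∀ z : Fin dx → ℝ,
        z + W2.mulVec (fun k => max (W1.mulVec z k + b1 k) 0) + 0
          = ∑ i, hatFn δ (a i) (v ⬝ᵥ z) • Y i := by
  classical
  let ι := (Fin r ⊕ Fin r ⊕ Fin r) ⊕ (Fin dx ⊕ Fin dx)
  have e : Fin (3 * r + 2 * dx) ≃ ι := (Fintype.equivFinOfCardEq (by simp [ι]; ring)).symm
  let A : ι → Fin dx → ℝ := Sum.elim (fun _ => v)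
    (Sum.elim (fun k => Pi.single k 1) (fun k => Pi.single k (-1)))
  let b : ι → ℝ := Sum.elim (Sum.elim (fun i => - a i + δ)
    (Sum.elim (fun i => - a i) (fun i => - a i - δ))) (fun _ => 0)
  let B : ι → Fin dx → ℝ := Sum.elim (Sum.elim (fun i => δ⁻¹ • Y i)
    (Sum.elim (fun i => (-2 * δ⁻¹) • Y i) (fun i => δ⁻¹ • Y i)))
    (Sum.elim (fun k => Pi.single k (-1)) (fun k => Pi.single k 1))
  refine ⟨fun k => A (e k), fun l k => B (e k) l, fun k => b (e k), fun z => ?_⟩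
  funext l
  have h1 : (Matrix.mulVec (fun l k => B (e k) l : Matrix (Fin dx) (Fin (3 * r + 2 * dx)) ℝ)
      (fun k => max (Matrix.mulVec (fun k => A (e k) : Matrix (Fin (3 * r + 2 * dx)) (Fin dx) ℝ) z k
        + b (e k)) 0)) l = ∑ m : ι, B m l * max (A m ⬝ᵥ z + b m) 0 :=
    e.sum_comp (fun m => B m l * max (A m ⬝ᵥ z + b m) 0)
  simp only [Pi.add_apply, h1, Pi.zero_apply, add_zero, Finset.sum_apply]
  simp only [ι, Fintype.sum_sum_type, A, b, B, Sum.elim_inl, Sum.elim_inr, Pi.smul_apply,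
    smul_eq_mul, single_dotProduct, add_zero]
  have h2 : ∑ k : Fin dx, (Pi.single k (-1) : Fin dx → ℝ) l * max (1 * z k) 0
      = - max (z l) 0 := by
    rw [Finset.sum_eq_single l]
    · simp
    · intro k _ hk; simp [Pi.single_apply, hk.symm]
    · simp
  have h3 : ∑ k : Fin dx, (Pi.single k 1 : Fin dx → ℝ) l * max (-1 * z k) 0
      = max (- z l) 0 := by
    rw [Finset.sum_eq_single l]
    · simp
    · intro k _ hk; simp [Pi.single_apply, hk.symm]
    · simp
  have h4 : z l - max (z l) 0 + max (- z l) 0 = 0 := by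
    rcases le_total (z l) 0 with h | h
    · rw [max_eq_right h, max_eq_left (by linarith)]; ring
    · rw [max_eq_left h, max_eq_right (by linarith)]; ring
  rw [h2, h3]
  have h5 : ∑ i, hatFn δ (a i) (v ⬝ᵥ z) * Y i l =
      ∑ i, δ⁻¹ * Y i l * max (v ⬝ᵥ z + (- a i + δ)) 0
      + (∑ i, -2 * δ⁻¹ * Y i l * max (v ⬝ᵥ z + - a i) 0
      + ∑ i, δ⁻¹ * Y i l * max (v ⬝ᵥ z + (- a i - δ)) 0) := by
    rw [← Finset.sum_add_distrib, ← Finset.sum_add_distrib]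
    refine Finset.sum_congr rfl fun i _ => ?_
    unfold hatFn
    rw [show v ⬝ᵥ z + (- a i + δ) = v ⬝ᵥ z - a i + δ by ring,
      show v ⬝ᵥ z + - a i = v ⬝ᵥ z - a i by ring,
      show v ⬝ᵥ z + (- a i - δ) = v ⬝ᵥ z - a i - δ by ring]
    ring
  rw [h5]
  linarith

/-- Lemma 1, memorization by one feed-forward layer: given `r` pairs with
pairwise distinct inputs, there is a single-token feed-forward (residual) layer of hidden
dimension at most `3r + 2dx` mapping each `x_i` to `y_i` padded with zeros, whose output
norm never exceeds `max_i ‖y_i‖₂`. -/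
theorem feedforward_memorization
    (dx dy r : ℕ) (hd : dy ≤ dx) (hr : 0 < r)
    (x : Fin r → Fin dx → ℝ) (y : Fin r → Fin dy → ℝ)
    (hx : ∀ i j : Fin r, i ≠ j → x i ≠ x j) :
    ∃ (W : ℕ) (_ : W ≤ 3 * r + 2 * dx)
      (W1 : Matrix (Fin W) (Fin dx) ℝ) (W2 : Matrix (Fin dx) (Fin W) ℝ)
      (b1 : Fin W → ℝ) (b2 : Fin dx → ℝ),
      (∀ i, (fun z : Fin dx → ℝ =>
          z + W2.mulVec (fun k => max (W1.mulVec z k + b1 k) 0) + b2) (x i)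
        = fun k : Fin dx => if h : (k : ℕ) < dy then y i ⟨k, h⟩ else 0) ∧
      ∀ z : Fin dx → ℝ,
        eucNorm (z + W2.mulVec (fun k => max (W1.mulVec z k + b1 k) 0) + b2)
          ≤ Finset.univ.sup' ⟨⟨0, hr⟩, Finset.mem_univ _⟩
              (fun i => eucNorm (y i)) := by
  obtain ⟨v, hv⟩ := exists_sep dx r x hx
  obtain ⟨δ, hδ, hgap⟩ := exists_gap r (fun i => v ⬝ᵥ x i) hv
  obtain ⟨W1, W2, b1, hF⟩ := layer_exists dx r v δ (fun i => v ⬝ᵥ x i) (fun i => padV (y i))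
  have key : ∀ (t : ℝ) (i : Fin r), |t - v ⬝ᵥ x i| < δ →
      ∑ j, hatFn δ (v ⬝ᵥ x j) t • (padV (y j) : Fin dx → ℝ)
        = hatFn δ (v ⬝ᵥ x i) t • padV (y i) := by
    intro t i hi
    refine Finset.sum_eq_single i (fun j _ hj => ?_) (by simp)
    rw [hatFn_zero hδ, zero_smul]
    have h1 := hgap j i hj
    have h2 := abs_sub_le (v ⬝ᵥ x j) t (v ⬝ᵥ x i)
    rw [abs_sub_comm (v ⬝ᵥ x j) t] at h2
    linarith
  refine ⟨_, le_rfl, W1, W2, b1, 0, fun i => ?_, fun z => ?_⟩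
  · simp only [hF]
    rw [key (v ⬝ᵥ x i) i (by simpa using hδ), hatFn_self hδ, one_smul]
    rfl
  · rw [hF]
    by_cases h : ∃ i, |v ⬝ᵥ z - v ⬝ᵥ x i| < δ
    · obtain ⟨i, hi⟩ := h
      rw [key _ i hi]
      have hm := hatFn_mem hδ (v ⬝ᵥ x i) (v ⬝ᵥ z)
      refine (eucNorm_smul_le _ hm.1 hm.2 _).trans ?_
      rw [eucNorm_padV hd]
      exact Finset.le_sup' (fun i => eucNorm (y i)) (Finset.mem_univ i)
    · push Not at h
      have h0 : ∑ i, hatFn δ (v ⬝ᵥ x i) (v ⬝ᵥ z) • (padV (y i) : Fin dx → ℝ) = 0 :=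
        Finset.sum_eq_zero fun i _ => by rw [hatFn_zero hδ _ _ (h i), zero_smul]
      rw [h0]
      have h1 : eucNorm (0 : Fin dx → ℝ) = 0 := by simp [eucNorm]
      rw [h1]
      exact (Real.sqrt_nonneg _).trans
        (Finset.le_sup' (fun i => eucNorm (y i)) (Finset.mem_univ (⟨0, hr⟩ : Fin r)))
end
end

section
/- Let n, K ∈ ℕ with K ≥ 1 and δ ∈ (0, 1/K). Define the multiple-step function step_K: [0,1] → ℝ by step_K(0) = 1/K and step_K(z) = ⌈K z⌉/K for z ∈ (0,1]. Then there exist b_0 ∈ ℝ and, for i = 1, …, 2nK − 2, weights w_i, u_i, v_i ∈ ℝ, such that the one-hidden-layer ReLU network f(z) = b_0 + Σ_{i=1}^{2nK−2} v_i·σ_R(w_i z + u_i) satisfies f(z + 2(j−1)) = step_K(z) + 2(j−1) for every j ∈ {1, …, n} and every z ∈ [0,1] not lying in ∪_{t=1}^{K−1} (t/K, t/K + δ). -/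
noncomputable section

/-- The multiple-step function `step_K : [0,1] → ℝ`, with `step_K(0) = 1/K` and
`step_K(z) = ⌈Kz⌉/K` for `z ∈ (0,1]`. -/
noncomputable def stepK (K : ℕ) (z : ℝ) : ℝ :=
  if z = 0 then 1 / (K : ℝ) else (⌈(K : ℝ) * z⌉ : ℝ) / K

/-- Start of the m-th ramp. -/
def ra (K m : ℕ) : ℝ :=
  if K ∣ m then 2 * ((m / K : ℕ) : ℝ) - 1 else 2 * ((m / K : ℕ) : ℝ) + ((m % K : ℕ) : ℝ) / K

/-- Width of the m-th ramp. -/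
def rd (K : ℕ) (δ : ℝ) (m : ℕ) : ℝ := if K ∣ m then 1 else δ

/-- Height of the m-th ramp. -/
def rh (K m : ℕ) : ℝ := 1 / K + if K ∣ m then 1 else 0

lemma sum_rh (K M : ℕ) :
    ∑ m ∈ Finset.range M, rh K (m + 1) = (M : ℝ) / K + ((M / K : ℕ) : ℝ) := by
  induction M with
  | zero => simp
  | succ M ih =>
    rw [Finset.sum_range_succ, ih, Nat.succ_div]
    unfold rh
    split_ifs <;> push_cast <;> ring

lemma sum_pairs (N : ℕ) (f : ℕ → ℝ) :
    ∑ i ∈ Finset.range (2 * N), f i = ∑ m ∈ Finset.range N, (f (2 * m) + f (2 * m + 1)) := by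
  induction N with
  | zero => simp
  | succ N ih =>
    rw [Finset.sum_range_succ, ← ih, show 2 * (N + 1) = 2 * N + 1 + 1 by ring,
      Finset.sum_range_succ, Finset.sum_range_succ]
    ring

lemma rd_pos (K : ℕ) (δ : ℝ) (hδ : 0 < δ) (m : ℕ) : 0 < rd K δ m := by
  unfold rd; split_ifs <;> linarith

lemma ramp_ge (a d h x : ℝ) (hd : 0 < d) (hx : a + d ≤ x) :
    h / d * max (1 * x + -a) 0 + -(h / d) * max (1 * x + -(a + d)) 0 = h := by
  rw [max_eq_left (by linarith), max_eq_left (by linarith)]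
  field_simp
  ring

lemma ramp_le (a d h x : ℝ) (hd : 0 < d) (hx : x ≤ a) :
    h / d * max (1 * x + -a) 0 + -(h / d) * max (1 * x + -(a + d)) 0 = 0 := by
  rw [max_eq_right (by linarith), max_eq_right (by linarith)]
  ring

lemma ra_before (K : ℕ) (hK : 1 ≤ K) (δ : ℝ) (hδK : δ < 1 / K) (j s m : ℕ)
    (hs : s < K) (z : ℝ) (hz0 : 0 ≤ z) (hzs : s = 0 ∨ (s : ℝ) / K + δ ≤ z)
    (hm : m ≤ j * K + s) : ra K m + rd K δ m ≤ z + 2 * (j : ℝ) := by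
  have hK0 : (0 : ℝ) < K := by exact_mod_cast hK
  have hq : m / K ≤ j := by
    rw [← Nat.lt_succ_iff, Nat.div_lt_iff_lt_mul hK, Nat.succ_mul]; omega
  have hdm := Nat.div_add_mod m K
  have hr := Nat.mod_lt m hK
  have hqR : ((m / K : ℕ) : ℝ) ≤ j := by exact_mod_cast hq
  unfold ra rd
  split_ifs with h
  · linarith
  · have hr0 : m % K ≠ 0 := fun h' => h (Nat.dvd_of_mod_eq_zero h')
    rcases hq.lt_or_eq with hlt | heq
    · have h1 : ((m / K : ℕ) : ℝ) + 1 ≤ j := by exact_mod_cast hlt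
      have h2 : ((m % K : ℕ) : ℝ) / K + 1 / K ≤ 1 := by
        rw [← add_div, div_le_one hK0]; exact_mod_cast hr
      linarith
    · have hrs : m % K ≤ s := by
        rw [heq, mul_comm] at hdm; omega
      have hz := hzs.resolve_left (by omega)
      have h2 : ((m % K : ℕ) : ℝ) / K ≤ (s : ℝ) / K := by
        gcongr
      linarith

lemma ra_after (K : ℕ) (hK : 1 ≤ K) (j s m : ℕ)
    (z : ℝ) (hz1 : z ≤ 1) (hzs : z ≤ ((s : ℝ) + 1) / K)
    (hm : j * K + s < m) : z + 2 * (j : ℝ) ≤ ra K m := by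
  have hK0 : (0 : ℝ) < K := by exact_mod_cast hK
  have hq : j ≤ m / K := by
    rw [Nat.le_div_iff_mul_le hK]; omega
  have hdm := Nat.div_add_mod m K
  have hnn : 0 ≤ ((m % K : ℕ) : ℝ) / K := by positivity
  unfold ra
  rcases hq.lt_or_eq with hlt | heq
  · have h1 : (j : ℝ) + 1 ≤ ((m / K : ℕ) : ℝ) := by exact_mod_cast hlt
    split_ifs with h <;> linarith
  · rw [← heq, mul_comm] at hdm
    have hrs : s + 1 ≤ m % K := by omega
    rw [if_neg (fun h => by have := Nat.mod_eq_zero_of_dvd h; omega), ← heq]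
    have h2 : ((s : ℝ) + 1) / K ≤ ((m % K : ℕ) : ℝ) / K := by
      gcongr; exact_mod_cast hrs
    linarith

lemma step_index (K : ℕ) (hK : 1 ≤ K) (δ : ℝ) (z : ℝ) (hz : z ∈ Set.Icc (0 : ℝ) 1)
    (h : ∀ t ∈ Finset.Icc 1 (K - 1), z ∉ Set.Ioo ((t : ℝ) / K) ((t : ℝ) / K + δ)) :
    ∃ s : ℕ, s < K ∧ (s = 0 ∨ (s : ℝ) / K + δ ≤ z) ∧ z ≤ ((s : ℝ) + 1) / K ∧
      stepK K z = ((s : ℝ) + 1) / K := by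
  have hK0 : (0 : ℝ) < K := by exact_mod_cast hK
  by_cases hz0 : z = 0
  · refine ⟨0, hK, Or.inl rfl, ?_, ?_⟩
    · rw [hz0]; positivity
    · simp [stepK, hz0]
  · have hzpos : 0 < z := lt_of_le_of_ne hz.1 (Ne.symm hz0)
    have hc : 0 < ⌈(K : ℝ) * z⌉ := Int.ceil_pos.mpr (by positivity)
    have hcK : ⌈(K : ℝ) * z⌉ ≤ K := Int.ceil_le.mpr (by push_cast; nlinarith [hz.2])
    obtain ⟨s, hs⟩ : ∃ s : ℕ, ⌈(K : ℝ) * z⌉ = s + 1 := ⟨(⌈(K : ℝ) * z⌉ - 1).toNat, by omega⟩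
    have h1 := Int.le_ceil ((K : ℝ) * z)
    have h2 := Int.ceil_lt_add_one ((K : ℝ) * z)
    rw [hs] at h1 h2
    push_cast at h1 h2
    refine ⟨s, by omega, ?_, ?_, ?_⟩
    · by_cases hs0 : s = 0
      · exact Or.inl hs0
      · right
        by_contra hlt
        refine h s (Finset.mem_Icc.mpr ⟨by omega, by omega⟩) ⟨?_, not_le.mp hlt⟩
        rw [div_lt_iff₀ hK0]; linarith
    · rw [le_div_iff₀ hK0]; linarith
    · rw [stepK, if_neg hz0, hs]; push_cast; rfl

/-- Step 2 of Proposition 2: a one-hidden-layer ReLU network with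
`2nK − 2` hidden units realizing, simultaneously on the `n` shifted copies `[2(j−1), 2j−1]`
of `[0,1]`, the shifted step function `step_K(z) + 2(j−1)` outside the trifling intervals. -/
theorem step_function_relu_network
    (n K : ℕ) (hn : 0 < n) (hK : 1 ≤ K) (δ : ℝ) (hδ : 0 < δ) (hδK : δ < 1 / K) :
    ∃ (b0 : ℝ) (w u v : Fin (2 * n * K - 2) → ℝ),
      ∀ j : Fin n, ∀ z ∈ Set.Icc (0 : ℝ) 1,
        (∀ t ∈ Finset.Icc 1 (K - 1), z ∉ Set.Ioo ((t : ℝ) / K) ((t : ℝ) / K + δ)) →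
        b0 + ∑ i, v i * max (w i * (z + 2 * (j : ℝ)) + u i) 0
          = stepK K z + 2 * (j : ℝ) := by
  let W : ℕ → ℝ := fun i => if i % 2 = 0 then -ra K (i / 2 + 1)
    else -(ra K (i / 2 + 1) + rd K δ (i / 2 + 1))
  let V : ℕ → ℝ := fun i => if i % 2 = 0 then rh K (i / 2 + 1) / rd K δ (i / 2 + 1)
    else -(rh K (i / 2 + 1) / rd K δ (i / 2 + 1))
  refine ⟨1 / K, fun _ => 1, fun i => W i, fun i => V i, ?_⟩
  intro j z hz hzt
  obtain ⟨s, hsK, hs1, hs2, hs3⟩ := step_index K hK δ z hz hzt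
  have hK0 : (0 : ℝ) < K := by exact_mod_cast hK
  rw [Fin.sum_univ_eq_sum_range (fun i => V i * max (1 * (z + 2 * ((j : ℕ) : ℝ)) + W i) 0),
    show 2 * n * K - 2 = 2 * (n * K - 1) by rw [mul_assoc]; omega, sum_pairs]
  have hM : (j : ℕ) * K + s ≤ n * K - 1 := by
    have := Nat.mul_le_mul_right K (Nat.succ_le_of_lt j.2)
    rw [Nat.succ_mul] at this
    omega
  have hsub : Finset.range ((j : ℕ) * K + s) ⊆ Finset.range (n * K - 1) :=
    Finset.range_subset_range.mpr hM
  have hV0 : ∀ m, V (2 * m) = rh K (m + 1) / rd K δ (m + 1) := fun m => by simp [V]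
  have hW0 : ∀ m, W (2 * m) = -ra K (m + 1) := fun m => by simp [W]
  have hdiv : ∀ m : ℕ, (2 * m + 1) / 2 = m := fun m => by omega
  have hmod : ∀ m : ℕ, ¬ (2 * m + 1) % 2 = 0 := fun m => by omega
  have hV1 : ∀ m, V (2 * m + 1) = -(rh K (m + 1) / rd K δ (m + 1)) := fun m => by
    simp only [V, hdiv, hmod, if_false]
  have hW1 : ∀ m, W (2 * m + 1) = -(ra K (m + 1) + rd K δ (m + 1)) := fun m => by
    simp only [W, hdiv, hmod, if_false]
  simp only [hV0, hW0, hV1, hW1]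
  rw [← Finset.sum_subset hsub, Finset.sum_congr rfl (g := fun m => rh K (m + 1)), sum_rh, hs3]
  · have : ((j : ℕ) * K + s) / K = j := by
      rw [Nat.mul_comm, Nat.mul_add_div hK, Nat.div_eq_of_lt hsK, add_zero]
    rw [this]
    push_cast
    field_simp
    ring
  · intro m hm
    exact ramp_ge _ _ _ _ (rd_pos K δ hδ _)
      (ra_before K hK δ hδK j s (m + 1) hsK z hz.1 hs1 (by have := Finset.mem_range.mp hm; omega))
  · intro m _ hm
    exact ramp_le _ _ _ _ (rd_pos K δ hδ _)
      (ra_after K hK j s (m + 1) z hz.2 hs2 (by rw [Finset.mem_range] at hm; omega))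
end
end
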